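/- Let s, s', k be nonnegative integers, δ, δ' ≥ 0 real, λ, λ' ∈ [0,1], and T > 0. If s + λ > s' + λ' and δ > δ', then the embedding of C^{k,s(s,λ,δ)}_T into C^{k,s(s',λ',δ')}_T is compact: every sequence bounded in the C^{k,s(s,λ,δ)}_T-norm has a subsequence converging in the C^{k,s(s',λ',δ')}_T-norm. -/

import Mathlib

open scoped BigOperators ENNReal Classical
open Filter MeasureTheory

noncomputable section

namespace NSdeRham

/-- Euclidean space `ℝⁿ`. -/
abbrev Spc (n : ℕ) := EuclideanSpace ℝ (Fin n)

variable {n : ℕ}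

/-- The weight `w(x) = √(1+|x|²)`. -/
def wt (x : Spc n) : ℝ := Real.sqrt (1 + ‖x‖ ^ 2)

/-- `w(x,y) = max (w x) (w y)`. -/
def wt2 (x y : Spc n) : ℝ := max (wt x) (wt y)

/-- Partial derivative in the `i`-th coordinate direction. -/
def pd (i : Fin n) (f : Spc n → ℝ) (x : Spc n) : ℝ :=
  fderiv ℝ f x (EuclideanSpace.single i 1)

/-- The Laplace operator `Δ = ∑ ∂²/∂xᵢ²`. -/
def lap (f : Spc n → ℝ) (x : Spc n) : ℝ := ∑ i : Fin n, pd i (pd i f) x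

section enorms

variable {F : Type*} [NormedAddCommGroup F]

/-- Weighted sup-"norm" `sup_x w(x)^δ ‖g x‖` (with values in `ℝ≥0∞`). -/
def eWSup (δ : ℝ) (g : Spc n → F) : ℝ≥0∞ :=
  ⨆ x : Spc n, ENNReal.ofReal (wt x ^ δ * ‖g x‖)

/-- Weighted Hölder seminorm `⟨g⟩_{λ,δ}`. -/
def eWHold (lam δ : ℝ) (g : Spc n → F) : ℝ≥0∞ :=
  ⨆ (x : Spc n) (y : Spc n) (_ : x ≠ y ∧ ‖x - y‖ ≤ ‖x‖ / 2),
    ENNReal.ofReal (wt2 x y ^ (δ + lam) * ‖g x - g y‖ / ‖x - y‖ ^ lam)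

/-- The ordinary Hölder norm on the (closed) unit ball around the origin. -/
def eOHold (lam : ℝ) (g : Spc n → F) : ℝ≥0∞ :=
  (⨆ (x : Spc n) (_ : ‖x‖ ≤ 1), ENNReal.ofReal ‖g x‖) +
    ⨆ (x : Spc n) (y : Spc n) (_ : ‖x‖ ≤ 1 ∧ ‖y‖ ≤ 1 ∧ x ≠ y),
      ENNReal.ofReal (‖g x - g y‖ / ‖x - y‖ ^ lam)

/-- The norm of `C^{0,λ,δ}`; for `λ = 0` this is just the weighted sup-norm. -/
def eHol0 (lam δ : ℝ) (g : Spc n → F) : ℝ≥0∞ :=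
  if lam = 0 then eWSup δ g else eOHold lam g + eWSup δ g + eWHold lam δ g

/-- The norm of the base anisotropic space `C^{𝐬(0,λ,δ)}_T`. -/
def eAniso0 (T lam δ : ℝ) (v : ℝ → Spc n → F) : ℝ≥0∞ :=
  (⨆ t : Set.Icc (0 : ℝ) T, eHol0 lam δ (v t)) +
    if lam = 0 then 0 else
      ⨆ (t₁ : Set.Icc (0 : ℝ) T) (t₂ : Set.Icc (0 : ℝ) T) (_ : (t₁ : ℝ) ≠ (t₂ : ℝ))
        (x : Spc n),
        ENNReal.ofReal (wt x ^ δ * ‖v t₁ x - v t₂ x‖ / |(t₁ : ℝ) - (t₂ : ℝ)| ^ (lam / 2))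

end enorms

/-- The norm of the static weighted Hölder space `C^{s,λ,δ}`. -/
def eHolS (s : ℕ) (lam δ : ℝ) (g : Spc n → ℝ) : ℝ≥0∞ :=
  ∑ m ∈ Finset.range (s + 1), eHol0 lam (δ + m) (iteratedFDeriv ℝ m g)

/-- Membership in the static weighted Hölder space `C^{s,λ,δ}`. -/
def HolSMem (s : ℕ) (lam δ : ℝ) (g : Spc n → ℝ) : Prop :=
  ContDiff ℝ s g ∧ eHolS s lam δ g ≠ ⊤

/-- Time derivative of order `j` (within `[0,T]`). -/
def tDeriv (T : ℝ) (j : ℕ) (u : ℝ → Spc n → ℝ) (t : ℝ) (x : Spc n) : ℝ :=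
  iteratedDerivWithin j (fun τ => u τ x) (Set.Icc 0 T) t

/-- Mixed derivative `∂_x^m ∂_t^j`. -/
def mixDeriv (T : ℝ) (m j : ℕ) (u : ℝ → Spc n → ℝ) (t : ℝ) :
    Spc n → ContinuousMultilinearMap ℝ (fun _ : Fin m => Spc n) ℝ :=
  iteratedFDeriv ℝ m (fun x => tDeriv T j u t x)

/-- The norm of the anisotropic weighted parabolic Hölder space `C^{k,𝐬(s,λ,δ)}_T`. -/
def eAnisoKS (T : ℝ) (k s : ℕ) (lam δ : ℝ) (u : ℝ → Spc n → ℝ) : ℝ≥0∞ :=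
  ∑ b ∈ Finset.range (k + 1), ∑ m ∈ Finset.range (2 * s + 1), ∑ j ∈ Finset.range (s + 1),
    if m + 2 * j ≤ 2 * s then eAniso0 T lam (δ + b + m) (mixDeriv T (b + m) j u) else 0

/-- Regularity required of members of `C^{k,𝐬(s,λ,δ)}_T`. -/
def AnisoReg (T : ℝ) (k s : ℕ) (u : ℝ → Spc n → ℝ) : Prop :=
  (∀ x : Spc n, ContDiffOn ℝ s (fun t => u t x) (Set.Icc 0 T)) ∧
  (∀ j : ℕ, j ≤ s → ∀ t ∈ Set.Icc (0 : ℝ) T,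
    ContDiff ℝ (2 * (s - j) + k) (fun x => tDeriv T j u t x)) ∧
  (∀ j m : ℕ, j ≤ s → m + 2 * j ≤ 2 * s + k →
    Continuous fun p : Set.Icc (0 : ℝ) T × Spc n => mixDeriv T m j u p.1 p.2)

/-- Membership in `C^{k,𝐬(s,λ,δ)}_T`. -/
def AnisoMem (T : ℝ) (k s : ℕ) (lam δ : ℝ) (u : ℝ → Spc n → ℝ) : Prop :=
  AnisoReg T k s u ∧ eAnisoKS T k s lam δ u ≠ ⊤

/-- The norm of `𝓕^{k,𝐬(s,λ,λ',δ)}_T = C^{k+1,𝐬(s,λ,δ)}_T ∩ C^{k,𝐬(s,λ',δ)}_T`. -/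
def eFn (T : ℝ) (k s : ℕ) (lam lam' δ : ℝ) (u : ℝ → Spc n → ℝ) : ℝ≥0∞ :=
  eAnisoKS T (k + 1) s lam δ u + eAnisoKS T k s lam' δ u

/-- Membership in `𝓕^{k,𝐬(s,λ,λ',δ)}_T`. -/
def FMem (T : ℝ) (k s : ℕ) (lam lam' δ : ℝ) (u : ℝ → Spc n → ℝ) : Prop :=
  AnisoReg T (k + 1) s u ∧ eFn T k s lam lam' δ u ≠ ⊤

/-- Index set of a basis of `Λ^q`. -/
abbrev Idx (n q : ℕ) := {I : Finset (Fin n) // I.card = q}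

/-- Static differential `q`-forms: coefficient functions. -/
abbrev FormS (n q : ℕ) := Idx n q → Spc n → ℝ

/-- Time-dependent differential `q`-forms. -/
abbrev FormT (n q : ℕ) := Idx n q → ℝ → Spc n → ℝ

/-- Fibre of the bundle `Λ^q`. -/
abbrev Fib (n q : ℕ) := Idx n q → ℝ

/-- The exterior derivative `d_q` on static `q`-forms. -/
def dS {q : ℕ} (u : FormS n q) : FormS n (q + 1) := fun J x =>
  ∑ i : Fin n,
    if h : i ∈ J.1 then
      (-1 : ℝ) ^ (J.1.filter fun j => j < i).card *
        pd i (u ⟨J.1.erase i, by simp [Finset.card_erase_of_mem h, J.2]⟩) x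
    else 0

/-- The exterior derivative `d_{q-1}` mapping `(q-1)`-forms to `q`-forms. -/
def dLowS {q : ℕ} (p : FormS n (q - 1)) : FormS n q := fun J x =>
  ∑ i : Fin n,
    if h : i ∈ J.1 ∧ (J.1.erase i).card = q - 1 then
      (-1 : ℝ) ^ (J.1.filter fun j => j < i).card * pd i (p ⟨J.1.erase i, h.2⟩) x
    else 0

/-- The formal adjoint `d_{q-1}^*` mapping `q`-forms to `(q-1)`-forms. -/
def coDS {q : ℕ} (u : FormS n q) : FormS n (q - 1) := fun K x =>
  -∑ i : Fin n,
    if h : i ∉ K.1 ∧ (insert i K.1).card = q then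
      (-1 : ℝ) ^ (K.1.filter fun j => j < i).card * pd i (u ⟨insert i K.1, h.2⟩) x
    else 0

/-- `d_q` on time-dependent forms. -/
def dT {q : ℕ} (u : FormT n q) : FormT n (q + 1) := fun J t => dS (fun I => u I t) J

/-- `d_{q-1}` on time-dependent forms. -/
def dLowT {q : ℕ} (p : FormT n (q - 1)) : FormT n q := fun J t => dLowS (fun I => p I t) J

/-- `d_{q-1}^*` on time-dependent forms. -/
def coDT {q : ℕ} (u : FormT n q) : FormT n (q - 1) := fun K t => coDS (fun I => u I t) K

/-- Norm of `C^{k,𝐬(s,λ,δ)}_{T,Λ^q}`. -/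
def eAnisoKSF {q : ℕ} (T : ℝ) (k s : ℕ) (lam δ : ℝ) (u : FormT n q) : ℝ≥0∞ :=
  ∑ I : Idx n q, eAnisoKS T k s lam δ (u I)

/-- Membership in `C^{k,𝐬(s,λ,δ)}_{T,Λ^q}`. -/
def CMemF {q : ℕ} (T : ℝ) (k s : ℕ) (lam δ : ℝ) (u : FormT n q) : Prop :=
  (∀ I, AnisoReg T k s (u I)) ∧ eAnisoKSF T k s lam δ u ≠ ⊤

/-- Graph norm of `C^{k,𝐬(s,λ,δ)}_{T,Λ^q,𝒟_{d⊕d*}}`. -/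
def eCD {q : ℕ} (T : ℝ) (k s : ℕ) (lam δ : ℝ) (u : FormT n q) : ℝ≥0∞ :=
  eAnisoKSF T k s lam δ u + eAnisoKSF T k s lam (δ + 1) (dT u) +
    eAnisoKSF T k s lam (δ + 1) (coDT u)

/-- Membership in `C^{k,𝐬(s,λ,δ)}_{T,Λ^q,𝒟_{d⊕d*}}`. -/
def CMemD {q : ℕ} (T : ℝ) (k s : ℕ) (lam δ : ℝ) (u : FormT n q) : Prop :=
  CMemF T k s lam δ u ∧ CMemF T k s lam (δ + 1) (dT u) ∧ CMemF T k s lam (δ + 1) (coDT u)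

/-- Norm of `𝓕^{k,𝐬(s,λ,λ',δ)}_{T,Λ^q}`. -/
def eFF {q : ℕ} (T : ℝ) (k s : ℕ) (lam lam' δ : ℝ) (u : FormT n q) : ℝ≥0∞ :=
  ∑ I : Idx n q, eFn T k s lam lam' δ (u I)

/-- Membership in `𝓕^{k,𝐬(s,λ,λ',δ)}_{T,Λ^q}`. -/
def FMemF {q : ℕ} (T : ℝ) (k s : ℕ) (lam lam' δ : ℝ) (u : FormT n q) : Prop :=
  (∀ I, AnisoReg T (k + 1) s (u I)) ∧ eFF T k s lam lam' δ u ≠ ⊤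

/-- Graph norm of `𝓕^{k,𝐬(s,λ,λ',δ)}_{T,Λ^q,𝒟_{d⊕d*}}`. -/
def eFD {q : ℕ} (T : ℝ) (k s : ℕ) (lam lam' δ : ℝ) (u : FormT n q) : ℝ≥0∞ :=
  eFF T k s lam lam' δ u + eFF T k s lam lam' (δ + 1) (dT u) +
    eFF T k s lam lam' (δ + 1) (coDT u)

/-- Membership in `𝓕^{k,𝐬(s,λ,λ',δ)}_{T,Λ^q,𝒟_{d⊕d*}}`. -/
def FMemD {q : ℕ} (T : ℝ) (k s : ℕ) (lam lam' δ : ℝ) (u : FormT n q) : Prop :=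
  FMemF T k s lam lam' δ u ∧ FMemF T k s lam lam' (δ + 1) (dT u) ∧
    FMemF T k s lam lam' (δ + 1) (coDT u)

/-- Norm of the static space `C^{s,λ,δ}_{Λ^q}`. -/
def eHolSF {q : ℕ} (s : ℕ) (lam δ : ℝ) (g : FormS n q) : ℝ≥0∞ :=
  ∑ I : Idx n q, eHolS s lam δ (g I)

/-- Membership in the static space `C^{s,λ,δ}_{Λ^q}`. -/
def HolMemF {q : ℕ} (s : ℕ) (lam δ : ℝ) (g : FormS n q) : Prop :=
  (∀ I, ContDiff ℝ s (g I)) ∧ eHolSF s lam δ g ≠ ⊤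

/-- Equality of time-dependent forms on `ℝⁿ × [0,T]`. -/
def EqOnT {q : ℕ} (T : ℝ) (u v : FormT n q) : Prop :=
  ∀ I, ∀ t ∈ Set.Icc (0 : ℝ) T, ∀ x, u I t x = v I t x

/-- The form `u` is co-closed (`d^* u = 0`) on `ℝⁿ × [0,T]`. -/
def CoClosed {q : ℕ} (T : ℝ) (u : FormT n q) : Prop :=
  ∀ K, ∀ t ∈ Set.Icc (0 : ℝ) T, ∀ x, coDT u K t x = 0

/-- Type of the bilinear zero order operator `M₁^{(q)}`. -/
abbrev M1Type (n q : ℕ) := (Fib n (q + 1) × Fib n (q - 1)) →ₗ[ℝ] Fib n q →ₗ[ℝ] Fib n q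

/-- Type of the bilinear zero order operator `M₂^{(q)}`. -/
abbrev M2Type (n q : ℕ) := Fib n q →ₗ[ℝ] Fib n q →ₗ[ℝ] Fib n (q - 1)

/-- Value of a time-dependent form at a point, as an element of the fibre. -/
def fib {q : ℕ} (u : FormT n q) (t : ℝ) (x : Spc n) : Fib n q := fun I => u I t x

/-- Value of `(d_q ⊕ d_{q-1}^*) u` at a point. -/
def ddFib {q : ℕ} (u : FormT n q) (t : ℝ) (x : Spc n) : Fib n (q + 1) × Fib n (q - 1) :=
  (fun J => dT u J t x, fun K => coDT u K t x)

/-- The operator `W_q u = M₁((d⊕d^*)u, w) + M₁((d⊕d^*)w, u)`. -/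
def Wop {q : ℕ} (M₁ : M1Type n q) (w u : FormT n q) : FormT n q := fun I t x =>
  M₁ (ddFib u t x) (fib w t x) I + M₁ (ddFib w t x) (fib u t x) I

/-- The symmetric bilinearization `B_q(w,u)` of the nonlinearity. -/
def Bop {q : ℕ} (M₁ : M1Type n q) (M₂ : M2Type n q) (w u : FormT n q) : FormT n q :=
  fun I t x =>
    Wop M₁ w u I t x +
      dLowT (fun K t' x' =>
        M₂ (fib u t' x') (fib w t' x') K + M₂ (fib w t' x') (fib u t' x') K) I t x

/-- The nonlinearity `𝒩_q u = M₁((d⊕d^*)u, u) + d_{q-1} M₂(u,u)`. -/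
def Nop {q : ℕ} (M₁ : M1Type n q) (M₂ : M2Type n q) (u : FormT n q) : FormT n q :=
  fun I t x =>
    M₁ (ddFib u t x) (fib u t x) I +
      dLowT (fun K t' x' => M₂ (fib u t' x') (fib u t' x') K) I t x

/-- Fundamental solution of the heat operator `∂_t - μΔ`. -/
def heatKer (μ : ℝ) (x : Spc n) (t : ℝ) : ℝ :=
  if 0 < t then (4 * Real.pi * μ * t) ^ (-(n : ℝ) / 2) * Real.exp (-‖x‖ ^ 2 / (4 * μ * t))
  else 0

/-- Volume heat potential `Ψ_μ`. -/
def volPot (μ : ℝ) (f : ℝ → Spc n → ℝ) (t : ℝ) (x : Spc n) : ℝ :=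
  ∫ τ in Set.Ioc (0 : ℝ) t, ∫ y : Spc n, heatKer μ (x - y) (t - τ) * f τ y

/-- Poisson heat potential `Ψ_{μ,0}`. -/
def poisPot (μ : ℝ) (g : Spc n → ℝ) (t : ℝ) (x : Spc n) : ℝ :=
  ∫ y : Spc n, heatKer μ (x - y) t * g y

/-- Volume heat potential acting coefficient-wise on forms. -/
def volPotF {q : ℕ} (μ : ℝ) (f : FormT n q) : FormT n q := fun I => volPot μ (f I)

/-- Poisson heat potential acting coefficient-wise on forms. -/
def poisPotF {q : ℕ} (μ : ℝ) (g : FormS n q) : FormT n q := fun I => poisPot μ (g I)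

/-- Area of the unit sphere in `ℝⁿ`. -/
def sphArea (n : ℕ) : ℝ := 2 * Real.pi ^ ((n : ℝ) / 2) / Real.Gamma ((n : ℝ) / 2)

/-- Standard fundamental solution of the Laplace operator in `ℝⁿ`. -/
def lapKer (n : ℕ) (x : Spc n) : ℝ :=
  if n = 2 then (1 / Real.pi) * Real.log ‖x‖
  else ‖x‖ ^ (2 - (n : ℝ)) / (sphArea n * (2 - (n : ℝ)))

/-- Newtonian potential. -/
def newtPot (f : Spc n → ℝ) (x : Spc n) : ℝ := ∫ y : Spc n, lapKer n (x - y) * f y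

/-- The integral operator `Φ_q` mapping `(q+1)`-forms to `q`-forms;
concretely `Φ_q f = -d^* (e * f)`. -/
def PhiOp {q : ℕ} (f : FormT n (q + 1)) : FormT n q := fun K t x =>
  -coDS (n := n) (q := q + 1) (fun J y => newtPot (fun z => f J t z) y) K x

/-- Squared `L²` norm of a form at time `t`. -/
def l2Sq {q : ℕ} (u : FormT n q) (t : ℝ) : ℝ :=
  ∑ I : Idx n q, ∫ x : Spc n, (u I t x) ^ 2

/-- Squared `L²` norm of the spatial gradient of a form at time `t`. -/
def gradSq {q : ℕ} (u : FormT n q) (t : ℝ) : ℝ :=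
  ∑ I : Idx n q, ∑ i : Fin n, ∫ x : Spc n, (pd i (fun y => u I t y) x) ^ 2

/-- The norm of `C^{0,𝐬(0,0,δ)}_{T,Λ^q}` (weighted sup-norm). -/
def eSupT {q : ℕ} (T δ : ℝ) (u : FormT n q) : ℝ≥0∞ :=
  ∑ I : Idx n q,
    ⨆ (t : Set.Icc (0 : ℝ) T) (x : Spc n), ENNReal.ofReal (wt x ^ δ * |u I t x|)

/-- The norm `‖∇u‖_{C^{0,𝐬(0,0,δ)}_{T}}` of the spatial gradient. -/
def eSupGradT {q : ℕ} (T δ : ℝ) (u : FormT n q) : ℝ≥0∞ :=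
  ∑ I : Idx n q, ∑ i : Fin n,
    ⨆ (t : Set.Icc (0 : ℝ) T) (x : Spc n),
      ENNReal.ofReal (wt x ^ δ * |pd i (fun y => u I t y) x|)

/-- `q`-form with coefficients harmonic polynomials of degree at most `m`. -/
def HarmPolyForm {q : ℕ} (m : ℕ) (h : FormS n q) : Prop :=
  ∀ I, (∃ P : MvPolynomial (Fin n) ℝ, P.totalDegree ≤ m ∧
      ∀ x : Spc n, h I x = MvPolynomial.eval (fun i => x i) P) ∧
    ∀ x : Spc n, lap (h I) x = 0

/-- Classical solution of the Cauchy problem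
`∂_t u - μ Δ u + extra = f` on `ℝⁿ × (0,T)`, `u(·,0) = u₀`. -/
def CauchySol {q : ℕ} (T μ : ℝ) (u extra f : FormT n q) (u₀ : FormS n q) : Prop :=
  (∀ I, ∀ t ∈ Set.Ioo (0 : ℝ) T, ∀ x,
    deriv (fun τ => u I τ x) t - μ * lap (fun y => u I t y) x + extra I t x = f I t x) ∧
  ∀ I x, u I 0 x = u₀ I x

/-- `Ψ_{μ,q} 𝒩_q u`. -/
def NopPot {q : ℕ} (μ : ℝ) (M₁ : M1Type n q) (M₂ : M2Type n q) (u : FormT n q) : FormT n q :=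
  volPotF μ (Nop M₁ M₂ u)

/-- `u + Ψ_{μ,q} 𝒩_q u`. -/
def TmapN {q : ℕ} (μ : ℝ) (M₁ : M1Type n q) (M₂ : M2Type n q) (u : FormT n q) : FormT n q :=
  u + NopPot μ M₁ M₂ u

/-- The linearization `u + Ψ_{μ,q} B_q(v,u)`. -/
def LmapB {q : ℕ} (μ : ℝ) (M₁ : M1Type n q) (M₂ : M2Type n q) (v u : FormT n q) :
    FormT n q :=
  u + volPotF μ (Bop M₁ M₂ v u)

/-- `Φ_q d_q Ψ_{μ,q} 𝒩_q u`. -/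
def PhiNpot {q : ℕ} (μ : ℝ) (M₁ : M1Type n q) (M₂ : M2Type n q) (u : FormT n q) :
    FormT n q :=
  PhiOp (dT (volPotF μ (Nop M₁ M₂ u)))

/-- `u + Φ_q d_q Ψ_{μ,q} 𝒩_q u`. -/
def PhiNmap {q : ℕ} (μ : ℝ) (M₁ : M1Type n q) (M₂ : M2Type n q) (u : FormT n q) :
    FormT n q :=
  u + PhiNpot μ M₁ M₂ u

/-- The linearization `u + Φ_q d_q Ψ_{μ,q} B_q(v,u)`. -/
def PhiLmap {q : ℕ} (μ : ℝ) (M₁ : M1Type n q) (M₂ : M2Type n q) (v u : FormT n q) :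
    FormT n q :=
  u + PhiOp (dT (volPotF μ (Bop M₁ M₂ v u)))

/-! ### Weights -/

lemma one_le_wt (x : Spc n) : 1 ≤ wt x := by
  unfold wt
  rw [Real.one_le_sqrt]
  nlinarith [sq_nonneg ‖x‖]

lemma wt_pos (x : Spc n) : 0 < wt x := lt_of_lt_of_le one_pos (one_le_wt x)

lemma norm_le_wt (x : Spc n) : ‖x‖ ≤ wt x := by
  unfold wt
  apply Real.le_sqrt_of_sq_le
  linarith

lemma wt_le_two_mul {x y : Spc n} (h : ‖x‖ ≤ 2 * ‖y‖) : wt x ≤ 2 * wt y := by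
  unfold wt
  rw [show (2 : ℝ) = Real.sqrt 4 by
    rw [show (4 : ℝ) = 2 ^ 2 by norm_num, Real.sqrt_sq (by norm_num)],
    ← Real.sqrt_mul (by norm_num)]
  apply Real.sqrt_le_sqrt
  nlinarith [norm_nonneg x, norm_nonneg y]

lemma wt_le_two_mul_of_near {x y : Spc n} (h : ‖x - y‖ ≤ ‖x‖ / 2) :
    wt x ≤ 2 * wt y ∧ wt y ≤ 2 * wt x := by
  have h1 : ‖x‖ ≤ ‖x - y‖ + ‖y‖ := by simpa using norm_add_le (x - y) y
  have h2 : ‖y‖ ≤ ‖x - y‖ + ‖x‖ := by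
    rw [norm_sub_rev]
    simpa using norm_add_le (y - x) x
  exact ⟨wt_le_two_mul (by linarith), wt_le_two_mul (by linarith [norm_nonneg x])⟩

lemma wt2_le_of_near {x y : Spc n} (h : ‖x - y‖ ≤ ‖x‖ / 2) :
    wt2 x y ≤ 2 * wt x ∧ wt2 x y ≤ 2 * wt y := by
  obtain ⟨h1, h2⟩ := wt_le_two_mul_of_near h
  exact ⟨max_le (by linarith [wt_pos x]) h2, max_le h1 (by linarith [wt_pos y])⟩

lemma one_le_wt2 (x y : Spc n) : 1 ≤ wt2 x y := (one_le_wt x).trans (le_max_left _ _)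

lemma wt2_pos (x y : Spc n) : 0 < wt2 x y := lt_of_lt_of_le one_pos (one_le_wt2 x y)

lemma one_le_wt_rpow (x : Spc n) {d : ℝ} (hd : 0 ≤ d) : 1 ≤ wt x ^ d :=
  Real.one_le_rpow (one_le_wt x) hd

/-! ### Real-valued form of the norm bounds -/

section bounds

variable {F : Type*} [NormedAddCommGroup F]

/-- All constituents of the norm of `C^{𝐬(0,λ,δ)}_T` are bounded by `C`. -/
structure AnisoBound (T lam d C : ℝ) (g : ℝ → Spc n → F) : Prop where
  sup : ∀ t ∈ Set.Icc (0 : ℝ) T, ∀ x, wt x ^ d * ‖g t x‖ ≤ C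
  loc : lam ≠ 0 → ∀ t ∈ Set.Icc (0 : ℝ) T, ∀ x y, ‖x‖ ≤ 1 → ‖y‖ ≤ 1 →
    ‖g t x - g t y‖ ≤ C * ‖x - y‖ ^ lam
  near : lam ≠ 0 → ∀ t ∈ Set.Icc (0 : ℝ) T, ∀ x y, ‖x - y‖ ≤ ‖x‖ / 2 →
    wt2 x y ^ (d + lam) * ‖g t x - g t y‖ ≤ C * ‖x - y‖ ^ lam
  time : lam ≠ 0 → ∀ t₁ ∈ Set.Icc (0 : ℝ) T, ∀ t₂ ∈ Set.Icc (0 : ℝ) T, ∀ x,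
    wt x ^ d * ‖g t₁ x - g t₂ x‖ ≤ C * |t₁ - t₂| ^ (lam / 2)

variable {T lam d C : ℝ} {g : ℝ → Spc n → F}

lemma AnisoBound.norm_le (h : AnisoBound T lam d C g) (hd : 0 ≤ d) {t : ℝ}
    (ht : t ∈ Set.Icc (0 : ℝ) T) (x : Spc n) : ‖g t x‖ ≤ C :=
  (le_mul_of_one_le_left (norm_nonneg _) (one_le_wt_rpow x hd)).trans (h.sup t ht x)

lemma AnisoBound.nonneg (h : AnisoBound T lam d C g) (hT : 0 < T) : 0 ≤ C :=
  (mul_nonneg (Real.rpow_nonneg (wt_pos 0).le _) (norm_nonneg _)).trans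
    (h.sup 0 ⟨le_rfl, hT.le⟩ 0)

lemma AnisoBound.mono (h : AnisoBound T lam d C g) {C' : ℝ} (hC : C ≤ C') :
    AnisoBound T lam d C' g where
  sup t ht x := (h.sup t ht x).trans hC
  loc hl t ht x y hx hy := (h.loc hl t ht x y hx hy).trans (by gcongr)
  near hl t ht x y hx := (h.near hl t ht x y hx).trans (by gcongr)
  time hl t₁ h₁ t₂ h₂ x := (h.time hl t₁ h₁ t₂ h₂ x).trans (by gcongr)

lemma AnisoBound.congr (h : AnisoBound T lam d C g) {g' : ℝ → Spc n → F}
    (hg : ∀ t ∈ Set.Icc (0 : ℝ) T, ∀ x, g' t x = g t x) : AnisoBound T lam d C g' where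
  sup t ht x := by rw [hg t ht]; exact h.sup t ht x
  loc hl t ht x y hx hy := by rw [hg t ht, hg t ht]; exact h.loc hl t ht x y hx hy
  near hl t ht x y hx := by rw [hg t ht, hg t ht]; exact h.near hl t ht x y hx
  time hl t₁ h₁ t₂ h₂ x := by rw [hg _ h₁, hg _ h₂]; exact h.time hl t₁ h₁ t₂ h₂ x

lemma AnisoBound.to_zero (h : AnisoBound T lam d C g) : AnisoBound T 0 d C g where
  sup := h.sup
  loc hl := absurd rfl hl
  near hl := absurd rfl hl
  time hl := absurd rfl hl

lemma AnisoBound.sub {C' : ℝ} {g' : ℝ → Spc n → F} (h : AnisoBound T lam d C g)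
    (h' : AnisoBound T lam d C' g') :
    AnisoBound T lam d (C + C') (fun t x => g t x - g' t x) where
  sup t ht x := by
    have h1 : wt x ^ d * ‖g t x - g' t x‖ ≤ wt x ^ d * (‖g t x‖ + ‖g' t x‖) := by
      gcongr
      · exact Real.rpow_nonneg (wt_pos x).le _
      · exact norm_sub_le _ _
    linarith [h.sup t ht x, h'.sup t ht x]
  loc hl t ht x y hx hy := by
    rw [sub_sub_sub_comm, add_mul]
    exact (norm_sub_le _ _).trans (add_le_add (h.loc hl t ht x y hx hy) (h'.loc hl t ht x y hx hy))
  near hl t ht x y hx := by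
    rw [sub_sub_sub_comm, add_mul]
    have h1 : wt2 x y ^ (d + lam) * ‖g t x - g t y - (g' t x - g' t y)‖ ≤
        wt2 x y ^ (d + lam) * (‖g t x - g t y‖ + ‖g' t x - g' t y‖) := by
      gcongr
      · exact Real.rpow_nonneg (wt2_pos x y).le _
      · exact norm_sub_le _ _
    linarith [h.near hl t ht x y hx, h'.near hl t ht x y hx]
  time hl t₁ h₁ t₂ h₂ x := by
    rw [sub_sub_sub_comm, add_mul]
    have h3 : wt x ^ d * ‖g t₁ x - g t₂ x - (g' t₁ x - g' t₂ x)‖ ≤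
        wt x ^ d * (‖g t₁ x - g t₂ x‖ + ‖g' t₁ x - g' t₂ x‖) := by
      gcongr
      · exact Real.rpow_nonneg (wt_pos x).le _
      · exact norm_sub_le _ _
    linarith [h.time hl t₁ h₁ t₂ h₂ x, h'.time hl t₁ h₁ t₂ h₂ x]

lemma AnisoBound.of_tendsto {gs : ℕ → ℝ → Spc n → F} (h : ∀ N, AnisoBound T lam d C (gs N))
    (hg : ∀ t ∈ Set.Icc (0 : ℝ) T, ∀ x, Tendsto (fun N => gs N t x) atTop (nhds (g t x))) :
    AnisoBound T lam d C g where
  sup t ht x := le_of_tendsto (((hg t ht x).norm).const_mul _)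
    (Eventually.of_forall fun N => (h N).sup t ht x)
  loc hl t ht x y hx hy := le_of_tendsto ((hg t ht x).sub (hg t ht y)).norm
    (Eventually.of_forall fun N => (h N).loc hl t ht x y hx hy)
  near hl t ht x y hx := le_of_tendsto (((hg t ht x).sub (hg t ht y)).norm.const_mul _)
    (Eventually.of_forall fun N => (h N).near hl t ht x y hx)
  time hl t₁ h₁ t₂ h₂ x := le_of_tendsto (((hg _ h₁ x).sub (hg _ h₂ x)).norm.const_mul _)
    (Eventually.of_forall fun N => (h N).time hl t₁ h₁ t₂ h₂ x)

lemma eAniso0_le (h : AnisoBound T lam d C g) (hT : 0 < T) (hd : 0 ≤ d) :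
    eAniso0 T lam d g ≤ ENNReal.ofReal (5 * C) := by
  have hC := h.nonneg hT
  have hdiv : ∀ {a r : ℝ}, lam ≠ 0 → 0 ≤ r → ∀ {e : ℝ}, 0 ≤ a → a ≤ C * r ^ e →
      a / r ^ e ≤ C := by
    intro a r _ hr e _ hle
    exact div_le_of_le_mul₀ (Real.rpow_nonneg hr _) hC hle
  have hsup : ∀ t : Set.Icc (0 : ℝ) T, eWSup d (g t) ≤ ENNReal.ofReal C := fun t =>
    iSup_le fun x => ENNReal.ofReal_le_ofReal (h.sup t t.2 x)
  by_cases hl : lam = 0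
  · simp only [eAniso0, eHol0, hl, if_true, add_zero]
    exact (iSup_le hsup).trans (ENNReal.ofReal_le_ofReal (by linarith))
  · have hspace : ∀ t : Set.Icc (0 : ℝ) T, eHol0 lam d (g t) ≤ ENNReal.ofReal (4 * C) := by
      intro t
      rw [eHol0, if_neg hl, show 4 * C = C + C + C + C by ring, ENNReal.ofReal_add (by linarith) hC,
        ENNReal.ofReal_add (by linarith) hC, ENNReal.ofReal_add hC hC]
      refine add_le_add (add_le_add (add_le_add ?_ ?_) (hsup t)) ?_
      · exact iSup_le fun x => iSup_le fun _ => ENNReal.ofReal_le_ofReal (h.norm_le hd t.2 x)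
      · refine iSup_le fun x => iSup_le fun y => iSup_le fun hxy => ENNReal.ofReal_le_ofReal ?_
        exact hdiv hl (norm_nonneg _) (norm_nonneg _) (h.loc hl t t.2 x y hxy.1 hxy.2.1)
      · refine iSup_le fun x => iSup_le fun y => iSup_le fun hxy => ENNReal.ofReal_le_ofReal ?_
        exact hdiv hl (norm_nonneg _)
          (mul_nonneg (Real.rpow_nonneg (wt2_pos x y).le _) (norm_nonneg _))
          (h.near hl t t.2 x y hxy.2)
    rw [eAniso0, if_neg hl, show 5 * C = 4 * C + C by ring, ENNReal.ofReal_add (by linarith) hC]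
    refine add_le_add (iSup_le hspace) ?_
    refine iSup_le fun t₁ => iSup_le fun t₂ => iSup_le fun _ => iSup_le fun x =>
      ENNReal.ofReal_le_ofReal ?_
    exact hdiv hl (abs_nonneg _)
      (mul_nonneg (Real.rpow_nonneg (wt_pos x).le _) (norm_nonneg _))
      (h.time hl t₁ t₁.2 t₂ t₂.2 x)

lemma AnisoBound.of_eAniso0_le (hC : 0 ≤ C)
    (h : eAniso0 T lam d g ≤ ENNReal.ofReal C) : AnisoBound T lam d C g := by
  have hmul : ∀ {a r e : ℝ}, 0 ≤ r → (r = 0 → a = 0) → a / r ^ e ≤ C → a ≤ C * r ^ e := by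
    intro a r e hr h0 hle
    rcases hr.eq_or_lt with h1 | h1
    · rw [h0 h1.symm]
      exact mul_nonneg hC (Real.rpow_nonneg hr _)
    · exact (div_le_iff₀ (Real.rpow_pos_of_pos h1 _)).1 hle
  have hspace : ∀ t ∈ Set.Icc (0 : ℝ) T, eHol0 lam d (g t) ≤ ENNReal.ofReal C := fun t ht =>
    ((le_iSup (fun t : Set.Icc (0 : ℝ) T => eHol0 lam d (g t)) ⟨t, ht⟩).trans
      le_self_add).trans h
  have hreal : ∀ {a : ℝ}, ENNReal.ofReal a ≤ ENNReal.ofReal C → a ≤ C := fun ha =>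
    (ENNReal.ofReal_le_ofReal_iff hC).1 ha
  refine ⟨fun t ht x => hreal ?_, fun hl t ht x y hx hy => ?_, fun hl t ht x y hxy => ?_,
    fun hl t₁ h₁ t₂ h₂ x => ?_⟩
  · refine le_trans ?_ (hspace t ht)
    refine (le_iSup (fun x => ENNReal.ofReal (wt x ^ d * ‖g t x‖)) x).trans ?_
    unfold eHol0
    split_ifs
    · exact le_rfl
    · exact le_add_right le_add_self
  · refine hmul (norm_nonneg _) (fun h0 => by
      rw [sub_eq_zero.1 (norm_eq_zero.1 h0), sub_self, norm_zero]) ?_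
    by_cases hxy : x = y
    · subst hxy; simpa using hC
    refine hreal (le_trans ?_ (hspace t ht))
    rw [eHol0, if_neg hl]
    refine le_add_right (le_add_right (le_trans ?_ le_add_self))
    exact le_iSup_of_le x (le_iSup_of_le y (le_iSup_of_le ⟨hx, hy, hxy⟩ le_rfl))
  · refine hmul (norm_nonneg _) (fun h0 => by
      rw [sub_eq_zero.1 (norm_eq_zero.1 h0), sub_self, norm_zero, mul_zero]) ?_
    by_cases hne : x = y
    · subst hne; simpa using hC
    refine hreal (le_trans ?_ (hspace t ht))
    rw [eHol0, if_neg hl]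
    refine le_trans ?_ le_add_self
    exact le_iSup_of_le x (le_iSup_of_le y (le_iSup_of_le ⟨hne, hxy⟩ le_rfl))
  · refine hmul (abs_nonneg _) (fun h0 => by
      rw [sub_eq_zero.1 (abs_eq_zero.1 h0), sub_self, norm_zero, mul_zero]) ?_
    by_cases hne : t₁ = t₂
    · subst hne; simpa using hC
    refine hreal (le_trans ?_ h)
    rw [eAniso0, if_neg hl]
    refine le_trans ?_ le_add_self
    exact le_iSup_of_le ⟨t₁, h₁⟩ (le_iSup_of_le ⟨t₂, h₂⟩ (le_iSup_of_le hne
      (le_iSup_of_le x le_rfl)))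

end bounds

/-! ### Interpolation -/

lemma rpow_mul_le_interp {A M q C R θ : ℝ} (hA : 0 ≤ A) (hq : 0 ≤ q) (hC : 0 ≤ C)
    (hR : 0 ≤ R) (hθ₀ : 0 ≤ θ) (hθ₁ : θ < 1) (h : q * A ≤ C * R) (hM : A ≤ M) :
    q ^ θ * A ≤ C ^ θ * M ^ (1 - θ) * R ^ θ := by
  have h1 : A = A ^ θ * A ^ (1 - θ) := by
    rw [← Real.rpow_add' hA (by norm_num)]
    simp
  calc q ^ θ * A = (q * A) ^ θ * A ^ (1 - θ) := by
        rw [Real.mul_rpow hq hA, mul_assoc, ← h1]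
    _ ≤ (C * R) ^ θ * M ^ (1 - θ) := by
        gcongr
    _ = _ := by
        rw [Real.mul_rpow hC hR]
        ring

section bounds

variable {F : Type*} [NormedAddCommGroup F] {T lam d C : ℝ} {g : ℝ → Spc n → F}

lemma AnisoBound.interp (h : AnisoBound T lam d C g) (hT : 0 < T) {lam' d' η : ℝ}
    (hlam' : 0 ≤ lam') (hl : lam' < lam) (hd' : 0 ≤ d') (hd : d' ≤ d)
    (hη : ∀ t ∈ Set.Icc (0 : ℝ) T, ∀ x, wt x ^ d' * ‖g t x‖ ≤ η) :
    AnisoBound T lam' d'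
      (η + C ^ (lam' / lam) * (2 * 2 ^ d' * η) ^ (1 - lam' / lam)) g := by
  have hlam : 0 < lam := hlam'.trans_lt hl
  have hC := h.nonneg hT
  have hη0 : 0 ≤ η := (mul_nonneg (Real.rpow_nonneg (wt_pos 0).le _) (norm_nonneg _)).trans
    (hη 0 ⟨le_rfl, hT.le⟩ 0)
  set θ := lam' / lam with hθ
  have hθ₀ : 0 ≤ θ := div_nonneg hlam' hlam.le
  have hθ₁ : θ < 1 := (div_lt_one hlam).2 hl
  have hθl : lam * θ = lam' := by rw [hθ]; field_simp
  have h2 : (1 : ℝ) ≤ 2 ^ d' := Real.one_le_rpow (by norm_num) hd'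
  have hM : 2 * η ≤ 2 * 2 ^ d' * η := by nlinarith
  set B := C ^ θ * (2 * 2 ^ d' * η) ^ (1 - θ) with hB
  have hB0 : 0 ≤ B := by positivity
  have hsmall : ∀ t ∈ Set.Icc (0 : ℝ) T, ∀ x, ‖g t x‖ ≤ η := fun t ht x =>
    (le_mul_of_one_le_left (norm_nonneg _) (one_le_wt_rpow x hd')).trans (hη t ht x)
  refine ⟨fun t ht x => (hη t ht x).trans (by linarith), fun _ t ht x y hx hy => ?_,
    fun _ t ht x y hxy => ?_, fun _ t₁ h₁ t₂ h₂ x => ?_⟩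
  · have h3 := rpow_mul_le_interp (norm_nonneg (g t x - g t y)) zero_le_one hC
      (Real.rpow_nonneg (norm_nonneg (x - y)) lam) hθ₀ hθ₁
      (by rw [one_mul]; exact h.loc hlam.ne' t ht x y hx hy)
      (M := 2 * 2 ^ d' * η)
      (by linarith [norm_sub_le (g t x) (g t y), hsmall t ht x, hsmall t ht y])
    rw [Real.one_rpow, one_mul, ← Real.rpow_mul (norm_nonneg _), hθl] at h3
    exact h3.trans (by gcongr; linarith)
  · have hw := wt2_pos x y
    obtain ⟨hwx, hwy⟩ := wt2_le_of_near hxy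
    have hpow : ∀ z : Spc n, wt2 x y ≤ 2 * wt z →
        wt2 x y ^ d' * ‖g t z‖ ≤ 2 ^ d' * η := by
      intro z hz
      calc wt2 x y ^ d' * ‖g t z‖ ≤ (2 * wt z) ^ d' * ‖g t z‖ := by gcongr
        _ = 2 ^ d' * (wt z ^ d' * ‖g t z‖) := by
          rw [Real.mul_rpow (by norm_num) (wt_pos z).le, mul_assoc]
        _ ≤ _ := by gcongr; exact hη t ht z
    have hA : wt2 x y ^ d' * ‖g t x - g t y‖ ≤ 2 * 2 ^ d' * η := by
      calc wt2 x y ^ d' * ‖g t x - g t y‖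
          ≤ wt2 x y ^ d' * (‖g t x‖ + ‖g t y‖) := by gcongr; exact norm_sub_le _ _
        _ ≤ _ := by linarith [hpow x hwx, hpow y hwy]
    have h3 := rpow_mul_le_interp (A := wt2 x y ^ d' * ‖g t x - g t y‖) (q := wt2 x y ^ lam)
      (by positivity) (by positivity) hC
      (Real.rpow_nonneg (norm_nonneg (x - y)) lam) hθ₀ hθ₁ ?_ hA
    · rw [← Real.rpow_mul hw.le, ← Real.rpow_mul (norm_nonneg _), hθl, ← mul_assoc,
        ← Real.rpow_add hw, add_comm lam' d'] at h3
      exact h3.trans (by gcongr; linarith)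
    · rw [← mul_assoc, ← Real.rpow_add hw]
      refine le_trans ?_ (h.near hlam.ne' t ht x y hxy)
      gcongr ?_ * _
      exact Real.rpow_le_rpow_of_exponent_le (one_le_wt2 x y) (by linarith)
  · have hw := wt_pos x
    have h3 := rpow_mul_le_interp (A := wt x ^ d' * ‖g t₁ x - g t₂ x‖)
      (M := 2 * 2 ^ d' * η)
      (by positivity) zero_le_one hC
      (Real.rpow_nonneg (abs_nonneg (t₁ - t₂)) (lam / 2)) hθ₀ hθ₁ ?_ ?_
    · rw [Real.one_rpow, one_mul, ← Real.rpow_mul (abs_nonneg _),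
        show lam / 2 * θ = lam' / 2 by rw [← hθl]; ring] at h3
      exact h3.trans (by gcongr; linarith)
    · rw [one_mul]
      refine le_trans ?_ (h.time hlam.ne' t₁ h₁ t₂ h₂ x)
      gcongr
      exact one_le_wt x
    · calc wt x ^ d' * ‖g t₁ x - g t₂ x‖
          ≤ wt x ^ d' * (‖g t₁ x‖ + ‖g t₂ x‖) := by gcongr; exact norm_sub_le _ _
        _ ≤ _ := by linarith [hη t₁ h₁ x, hη t₂ h₂ x]

/-! ### Equicontinuity and extraction of subsequences -/

lemma AnisoBound.exists_modulus (T C : ℝ) (F : Type*) [NormedAddCommGroup F] (d : ℝ)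
    (hlam : 0 < lam) (hd : 0 ≤ d) (x : Spc n) {ε : ℝ} (hε : 0 < ε) :
    ∃ ρ > 0, ∀ g : ℝ → Spc n → F, AnisoBound T lam d C g →
      ∀ t ∈ Set.Icc (0 : ℝ) T, ∀ t' ∈ Set.Icc (0 : ℝ) T, ∀ y, |t - t'| < ρ → ‖x - y‖ < ρ →
        ‖g t x - g t' y‖ < ε := by
  have hlim : ∀ e : ℝ, 0 < e → ∃ ρ > 0, ∀ r, 0 ≤ r → r < ρ → C * r ^ e < ε / 2 := by
    intro e he
    have h1 : Tendsto (fun r : ℝ => C * r ^ e) (nhds 0) (nhds (C * 0 ^ e)) :=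
      ((Real.continuousAt_rpow_const 0 e (Or.inr he.le)).tendsto).const_mul C
    rw [Real.zero_rpow he.ne', mul_zero] at h1
    obtain ⟨ρ, hρ, h2⟩ := Metric.eventually_nhds_iff.1 (h1.eventually_lt_const (half_pos hε))
    refine ⟨ρ, hρ, fun r hr0 hr => h2 ?_⟩
    rwa [Real.dist_eq, sub_zero, abs_of_nonneg hr0]
  obtain ⟨ρ₁, hρ₁, h₁⟩ := hlim lam hlam
  obtain ⟨ρ₂, hρ₂, h₂⟩ := hlim (lam / 2) (half_pos hlam)
  obtain ⟨ρ₃, hρ₃, h₃⟩ : ∃ ρ > 0, ∀ y : Spc n, ‖x - y‖ < ρ →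
      ‖x - y‖ ≤ ‖x‖ / 2 ∨ (‖x‖ ≤ 1 ∧ ‖y‖ ≤ 1) := by
    by_cases hx : x = 0
    · refine ⟨1, one_pos, fun y hy => Or.inr ?_⟩
      subst hx
      simp only [zero_sub, norm_neg] at hy
      exact ⟨by simp, hy.le⟩
    · exact ⟨‖x‖ / 2, half_pos (norm_pos_iff.2 hx), fun y hy => Or.inl hy.le⟩
  refine ⟨min ρ₁ (min ρ₂ ρ₃), by positivity, fun g hg t ht t' ht' y hty hxy => ?_⟩
  simp only [lt_min_iff] at hty hxy
  have hT1 : ‖g t x - g t' x‖ < ε / 2 := by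
    refine lt_of_le_of_lt ?_ (h₂ _ (abs_nonneg _) hty.2.1)
    exact (le_mul_of_one_le_left (norm_nonneg _) (one_le_wt_rpow x hd)).trans
      (hg.time hlam.ne' t ht t' ht' x)
  have hX1 : ‖g t' x - g t' y‖ < ε / 2 := by
    refine lt_of_le_of_lt ?_ (h₁ _ (norm_nonneg _) hxy.1)
    rcases h₃ y hxy.2.2 with h | ⟨hx, hy⟩
    · exact (le_mul_of_one_le_left (norm_nonneg _)
        (Real.one_le_rpow (one_le_wt2 x y) (by linarith))).trans (hg.near hlam.ne' t' ht' x y h)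
    · exact hg.loc hlam.ne' t' ht' x y hx hy
  linarith [norm_sub_le_norm_sub_add_norm_sub (g t x) (g t' x) (g t' y)]

lemma AnisoBound.continuous (h : AnisoBound T lam d C g) (hlam : 0 < lam) (hd : 0 ≤ d) :
    Continuous fun p : Set.Icc (0 : ℝ) T × Spc n => g p.1 p.2 := by
  rw [Metric.continuous_iff]
  rintro ⟨t, x⟩ ε hε
  obtain ⟨ρ, hρ, hmod⟩ := AnisoBound.exists_modulus T C F d hlam hd x hε
  refine ⟨ρ, hρ, fun q hq => ?_⟩
  rw [dist_comm, Prod.dist_eq, max_lt_iff, Subtype.dist_eq, Real.dist_eq, dist_eq_norm] at hq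
  rw [dist_comm, dist_eq_norm]
  exact hmod g h t t.2 q.1 q.1.2 q.2 hq.1 hq.2

lemma AnisoBound.eventually_sup_le {hs : ℕ → ℝ → Spc n → F}
    (h : ∀ N, AnisoBound T lam d C (hs N)) (hlam : 0 < lam) {d' : ℝ} (hd' : 0 ≤ d')
    (hd : d' < d)
    (hlim : ∀ t ∈ Set.Icc (0 : ℝ) T, ∀ x, Tendsto (fun N => hs N t x) atTop (nhds 0))
    {η : ℝ} (hη : 0 < η) :
    ∀ᶠ N in atTop, ∀ t ∈ Set.Icc (0 : ℝ) T, ∀ x, wt x ^ d' * ‖hs N t x‖ ≤ η := by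
  have hdecay : ∃ R : ℝ, 1 ≤ R ∧ ∀ w, R ≤ w → w ^ (d' - d) * C ≤ η := by
    have h1 : Tendsto (fun w : ℝ => w ^ (-(d - d')) * C) atTop (nhds (0 * C)) :=
      (tendsto_rpow_neg_atTop (by linarith)).mul_const C
    rw [zero_mul] at h1
    obtain ⟨R, hR⟩ := eventually_atTop.1 (h1.eventually_le_const hη)
    refine ⟨max R 1, le_max_right _ _, fun w hw => ?_⟩
    have := hR w ((le_max_left _ _).trans hw)
    rwa [neg_sub] at this
  obtain ⟨R, hR1, hR⟩ := hdecay
  have hR0 : 0 < R := by linarith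
  have hε : 0 < η / R ^ d' := by positivity
  have hK : IsCompact (Set.Icc (0 : ℝ) T ×ˢ Metric.closedBall (0 : Spc n) R) :=
    isCompact_Icc.prod (isCompact_closedBall _ _)
  have hunif : ∀ᶠ N in atTop, ∀ p ∈ Set.Icc (0 : ℝ) T ×ˢ Metric.closedBall (0 : Spc n) R,
      ‖hs N p.1 p.2‖ < η / R ^ d' := by
    refine hK.induction_on (p := fun S => ∀ᶠ N in atTop, ∀ p ∈ S, ‖hs N p.1 p.2‖ < η / R ^ d')
      (by simp) (fun S S' hSS' hS' => hS'.mono fun N hN p hp => hN p (hSS' hp))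
      (fun S S' hS hS' => ?_) ?_
    · filter_upwards [hS, hS'] with N h1 h2 p hp
      exact hp.elim (h1 p) (h2 p)
    · rintro ⟨t, x⟩ ⟨ht, -⟩
      obtain ⟨ρ, hρ, hmod⟩ := AnisoBound.exists_modulus T C F d hlam (hd'.trans hd.le) x
        (half_pos hε)
      refine ⟨(Set.Icc (0 : ℝ) T ×ˢ Metric.closedBall (0 : Spc n) R) ∩ Metric.ball (t, x) ρ,
        inter_mem_nhdsWithin _ (Metric.ball_mem_nhds _ hρ), ?_⟩
      filter_upwards [(hlim t ht x).norm.eventually_lt_const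
        (by rw [norm_zero]; exact half_pos hε)] with N hN p hp
      have hdist := Metric.mem_ball'.1 hp.2
      rw [Prod.dist_eq, max_lt_iff, Real.dist_eq, dist_eq_norm] at hdist
      have h1 := hmod (hs N) (h N) t ht p.1 hp.1.1 p.2 hdist.1 hdist.2
      rw [norm_sub_rev] at h1
      linarith [norm_le_norm_sub_add (hs N p.1 p.2) (hs N t x)]
  filter_upwards [hunif] with N hN t ht x
  by_cases hx : R ≤ wt x
  · calc wt x ^ d' * ‖hs N t x‖ = wt x ^ (d' - d) * (wt x ^ d * ‖hs N t x‖) := by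
          rw [← mul_assoc, ← Real.rpow_add (wt_pos x), sub_add_cancel]
      _ ≤ wt x ^ (d' - d) * C := by
          gcongr
          · exact Real.rpow_nonneg (wt_pos x).le _
          · exact (h N).sup t ht x
      _ ≤ η := hR _ hx
  · push Not at hx
    have hxR : x ∈ Metric.closedBall (0 : Spc n) R := by
      rw [mem_closedBall_zero_iff]
      exact (norm_le_wt x).trans hx.le
    have h1 := (hN (t, x) ⟨ht, hxR⟩).le
    calc wt x ^ d' * ‖hs N t x‖ ≤ R ^ d' * (η / R ^ d') := by
          gcongr
          exact (wt_pos x).le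
      _ = η := by field_simp

lemma AnisoBound.eventually_of_tendsto {hs : ℕ → ℝ → Spc n → F}
    (h : ∀ N, AnisoBound T lam d C (hs N)) (hT : 0 < T) {lam' d' : ℝ}
    (hlam' : 0 ≤ lam') (hl : lam' < lam) (hd' : 0 ≤ d') (hd : d' < d)
    (hlim : ∀ t ∈ Set.Icc (0 : ℝ) T, ∀ x, Tendsto (fun N => hs N t x) atTop (nhds 0))
    {ε : ℝ} (hε : 0 < ε) :
    ∀ᶠ N in atTop, AnisoBound T lam' d' ε (hs N) := by
  have hlam : 0 < lam := hlam'.trans_lt hl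
  have hθ : 0 < 1 - lam' / lam := sub_pos.2 ((div_lt_one hlam).2 hl)
  have hc : Tendsto (fun η : ℝ => η + C ^ (lam' / lam) * (2 * 2 ^ d' * η) ^ (1 - lam' / lam))
      (nhds 0) (nhds 0) := by
    have h1 : ContinuousAt
        (fun η : ℝ => η + C ^ (lam' / lam) * (2 * 2 ^ d' * η) ^ (1 - lam' / lam)) 0 :=
      continuousAt_id.add (continuousAt_const.mul
        ((continuousAt_const.mul continuousAt_id).rpow_const (Or.inr hθ.le)))
    have h2 := h1.tendsto
    simpa [Real.zero_rpow hθ.ne'] using h2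
  obtain ⟨η, hη1, hη0⟩ := (((hc.mono_left nhdsWithin_le_nhds).eventually_le_const hε).and
    (self_mem_nhdsWithin (a := (0 : ℝ)) (s := Set.Ioi 0))).exists
  filter_upwards [AnisoBound.eventually_sup_le h hlam hd' hd hlim hη0] with N hN
  exact ((h N).interp hT hlam' hl hd' hd.le hN).mono hη1

lemma AnisoBound.exists_subseq [ProperSpace F] {gs : ℕ → ℝ → Spc n → F}
    (h : ∀ N, AnisoBound T lam d C (gs N)) (hT : 0 < T) (hlam : 0 < lam) (hd : 0 ≤ d) :
    ∃ φ : ℕ → ℕ, StrictMono φ ∧ ∃ G : ℝ → Spc n → F, ∀ t ∈ Set.Icc (0 : ℝ) T, ∀ x,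
      Tendsto (fun N => gs (φ N) t x) atTop (nhds (G t x)) := by
  have : Nonempty (Set.Icc (0 : ℝ) T × Spc n) := ⟨(⟨0, le_rfl, hT.le⟩, 0)⟩
  let D := TopologicalSpace.denseSeq (Set.Icc (0 : ℝ) T × Spc n)
  have hcomp : IsCompact (Set.univ.pi fun _ : ℕ => Metric.closedBall (0 : F) C) :=
    isCompact_univ_pi fun _ => isCompact_closedBall _ _
  obtain ⟨a, -, φ, hφ, hlim⟩ := hcomp.tendsto_subseq
    (x := fun N i => gs N (D i).1 (D i).2) fun N i _ => by
      rw [mem_closedBall_zero_iff]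
      exact (h N).norm_le hd (D i).1.2 _
  rw [tendsto_pi_nhds] at hlim
  have hlim' : ∀ t ∈ Set.Icc (0 : ℝ) T, ∀ x, ∃ b,
      Tendsto (fun N => gs (φ N) t x) atTop (nhds b) := by
    intro t ht x
    refine cauchySeq_tendsto_of_complete (Metric.cauchySeq_iff'.2 fun ε hε => ?_)
    obtain ⟨ρ, hρ, hmod⟩ := AnisoBound.exists_modulus T C F d hlam hd x
      (show 0 < ε / 3 by positivity)
    obtain ⟨q, hq, i, rfl⟩ := Metric.dense_iff.1
      (TopologicalSpace.denseRange_denseSeq (Set.Icc (0 : ℝ) T × Spc n)) (⟨t, ht⟩, x) ρ hρ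
    have hdist := Metric.mem_ball'.1 hq
    rw [Prod.dist_eq, max_lt_iff, Subtype.dist_eq, Real.dist_eq, dist_eq_norm] at hdist
    obtain ⟨N, hN⟩ := Metric.cauchySeq_iff'.1 (hlim i).cauchySeq (ε / 3) (by positivity)
    refine ⟨N, fun m hm => ?_⟩
    have h1 := hmod _ (h (φ m)) t ht _ (D i).1.2 _ hdist.1 hdist.2
    have h2 := hmod _ (h (φ N)) t ht _ (D i).1.2 _ hdist.1 hdist.2
    have h3 := hN m hm
    rw [← dist_eq_norm] at h1 h2
    rw [dist_comm] at h2
    simp only [Function.comp] at h3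
    linarith [dist_triangle4 (gs (φ m) t x) (gs (φ m) (D i).1 (D i).2)
      (gs (φ N) (D i).1 (D i).2) (gs (φ N) t x)]
  choose! G hG using hlim'
  exact ⟨φ, hφ, G, hG⟩

end bounds

/-! ### Differentiating limits -/

lemma hasFTaylorSeriesUpTo_of_tendstoUniformly {E F : Type*} [NormedAddCommGroup E]
    [NormedSpace ℝ E] [NormedAddCommGroup F] [NormedSpace ℝ F] {P : ℕ} {f : ℕ → E → F}
    (hf : ∀ N, ContDiff ℝ P (f N)) {G : E → FormalMultilinearSeries ℝ E F}
    (hG : ∀ m ≤ P, TendstoUniformly (fun N => iteratedFDeriv ℝ m (f N)) (fun x => G x m) atTop) :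
    HasFTaylorSeriesUpTo P (fun x => (G x 0).curry0) G where
  zero_eq _ := rfl
  fderiv m hm x := by
    have hm' : m < P := by exact_mod_cast hm
    refine hasFDerivAt_of_tendstoUniformly (g' := fun x => (G x m.succ).curryLeft)
      (f := fun N => iteratedFDeriv ℝ m (f N))
      (f' := fun N x => (iteratedFDeriv ℝ (m + 1) (f N) x).curryLeft) (l := atTop) ?_ ?_ ?_ x
    · have h1 := (continuousMultilinearCurryLeftEquiv ℝ (fun _ : Fin (m + 1) => E)
        F).isometry.uniformContinuous.comp_tendstoUniformly (hG (m + 1) hm')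
      exact h1
    · exact fun N y => (hf N).ftaylorSeries.fderiv m hm y
    · exact fun y => (hG m hm'.le).tendsto_at y
  cont m hm := by
    have hm' : m ≤ P := by exact_mod_cast hm
    exact (hG m hm').continuous
      (Frequently.of_forall fun N => (hf N).continuous_iteratedFDeriv (by exact_mod_cast hm'))

lemma hasDerivWithinAt_Icc_of_integral {F : Type*} [NormedAddCommGroup F] [NormedSpace ℝ F]
    [CompleteSpace F] {T : ℝ} (hT : 0 ≤ T) {g g' : ℝ → F}
    (hg' : ContinuousOn g' (Set.Icc 0 T))
    (h : ∀ t ∈ Set.Icc (0 : ℝ) T, g t - g 0 = ∫ τ in (0 : ℝ)..t, g' τ) {t : ℝ}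
    (ht : t ∈ Set.Icc (0 : ℝ) T) : HasDerivWithinAt g (g' t) (Set.Icc 0 T) t := by
  have hc : Continuous (Set.IccExtend hT ((Set.Icc 0 T).domRestrict g')) :=
    hg'.domRestrict.Icc_extend'
  have h1 := (hc.integral_hasStrictDerivAt 0 t).hasDerivAt.hasDerivWithinAt (s := Set.Icc 0 T)
  have h2 := h1.const_add (g 0)
  rw [Set.IccExtend_of_mem _ _ ht] at h2
  refine h2.congr_of_mem (fun τ hτ => ?_) ht
  rw [← sub_eq_iff_eq_add', h τ hτ]
  refine intervalIntegral.integral_congr fun r hr => ?_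
  rw [Set.uIcc_of_le hτ.1] at hr
  rw [Set.IccExtend_of_mem _ _ ⟨hr.1, hr.2.trans hτ.2⟩]
  rfl

lemma integral_iteratedDerivWithin_Icc {T : ℝ} {s j : ℕ} {f : ℝ → ℝ}
    (hT : 0 < T) (hf : ContDiffOn ℝ s f (Set.Icc 0 T)) (hj : j < s) {a b : ℝ} (ha : 0 ≤ a)
    (hab : a ≤ b) (hb : b ≤ T) :
    ∫ τ in a..b, iteratedDerivWithin (j + 1) f (Set.Icc 0 T) τ =
      iteratedDerivWithin j f (Set.Icc 0 T) b - iteratedDerivWithin j f (Set.Icc 0 T) a := by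
  have hu := uniqueDiffOn_Icc hT
  have hsub : Set.Icc a b ⊆ Set.Icc 0 T := Set.Icc_subset_Icc ha hb
  have hc : ContinuousOn (iteratedDerivWithin (j + 1) f (Set.Icc 0 T)) (Set.Icc 0 T) :=
    hf.continuousOn_iteratedDerivWithin (by exact_mod_cast hj) hu
  have hd : DifferentiableOn ℝ (iteratedDerivWithin j f (Set.Icc 0 T)) (Set.Icc 0 T) :=
    hf.differentiableOn_iteratedDerivWithin (by exact_mod_cast hj) hu
  refine intervalIntegral.integral_eq_sub_of_hasDerivAt_of_le hab (hd.continuousOn.mono hsub)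
    (fun x hx => ?_) ?_
  · rw [iteratedDerivWithin_succ]
    exact (hd x (hsub ⟨hx.1.le, hx.2.le⟩)).hasDerivWithinAt.hasDerivAt
      (Icc_mem_nhds (ha.trans_lt hx.1) (hx.2.trans_le hb))
  · exact (hc.mono (by rwa [Set.uIcc_of_le hab])).intervalIntegrable

lemma contDiffOn_Icc_of_tendstoUniformlyOn {T : ℝ} (hT : 0 < T) {s : ℕ} {f : ℕ → ℝ → ℝ}
    (hf : ∀ N, ContDiffOn ℝ s (f N) (Set.Icc 0 T)) {g : ℕ → ℝ → ℝ}
    (hg : ∀ j ≤ s, TendstoUniformlyOn (fun N => iteratedDerivWithin j (f N) (Set.Icc 0 T)) (g j)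
      atTop (Set.Icc 0 T)) :
    ContDiffOn ℝ s (g 0) (Set.Icc 0 T) ∧
      ∀ j ≤ s, Set.EqOn (iteratedDerivWithin j (g 0) (Set.Icc 0 T)) (g j) (Set.Icc 0 T) := by
  have hu := uniqueDiffOn_Icc hT
  have hfc : ∀ N, ∀ j ≤ s, ContinuousOn (iteratedDerivWithin j (f N) (Set.Icc 0 T))
      (Set.Icc 0 T) := fun N j hj =>
    (hf N).continuousOn_iteratedDerivWithin (by exact_mod_cast hj) hu
  have hgc : ∀ j ≤ s, ContinuousOn (g j) (Set.Icc 0 T) := fun j hj =>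
    (hg j hj).continuousOn (Frequently.of_forall fun N => hfc N j hj)
  have hder : ∀ j < s, ∀ t ∈ Set.Icc (0 : ℝ) T,
      HasDerivWithinAt (g j) (g (j + 1) t) (Set.Icc 0 T) t := by
    intro j hj t ht
    refine hasDerivWithinAt_Icc_of_integral hT.le (hgc (j + 1) hj) (fun τ hτ => ?_) ht
    have hsub : Set.uIcc 0 τ ⊆ Set.Icc 0 T := by
      rw [Set.uIcc_of_le hτ.1]
      exact Set.Icc_subset_Icc le_rfl hτ.2
    have h1 := ((hg (j + 1) hj).mono hsub).tendsto_intervalIntegral_of_continuousOn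
      (μ := volume) (Eventually.of_forall fun N => (hfc N (j + 1) hj).mono hsub)
    refine tendsto_nhds_unique ?_ h1
    simp_rw [integral_iteratedDerivWithin_Icc hT (hf _) hj le_rfl hτ.1 hτ.2]
    exact ((hg j hj.le).tendsto_at hτ).sub ((hg j hj.le).tendsto_at ⟨le_rfl, hT.le⟩)
  have heq : ∀ j ≤ s, Set.EqOn (iteratedDerivWithin j (g 0) (Set.Icc 0 T)) (g j)
      (Set.Icc 0 T) := by
    intro j
    induction j with
    | zero => intro _ t _; simp
    | succ j ih =>
      intro hj t ht
      rw [iteratedDerivWithin_succ, derivWithin_congr (ih (by omega)) (ih (by omega) ht)]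
      exact (hder j hj t ht).derivWithin (hu t ht)
  refine ⟨?_, heq⟩
  refine contDiffOn_of_continuousOn_differentiableOn_deriv (n := (s : ℕ∞)) (fun m hm => ?_)
    fun m hm => ?_
  · have hm' : m ≤ s := by exact_mod_cast hm
    exact (hgc m hm').congr (heq m hm')
  · have hm' : m < s := by exact_mod_cast hm
    exact DifferentiableOn.congr (fun t ht => (hder m hm' t ht).differentiableWithinAt)
      (heq m hm'.le)

/-! ### The spaces `C^{k,𝐬(s,λ,δ)}_T` -/

lemma exists_common_subseq {ι : Type*} (S : Finset ι) {F : ι → Type*}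
    [∀ i, NormedAddCommGroup (F i)] [∀ i, ProperSpace (F i)] {T lam C : ℝ} {d : ι → ℝ}
    (hT : 0 < T) (hlam : 0 < lam) (hd : ∀ i, 0 ≤ d i) (gs : ∀ i, ℕ → ℝ → Spc n → F i)
    (h : ∀ i ∈ S, ∀ N, AnisoBound T lam (d i) C (gs i N)) :
    ∃ φ : ℕ → ℕ, StrictMono φ ∧ ∃ G : ∀ i, ℝ → Spc n → F i, ∀ i ∈ S,
      ∀ t ∈ Set.Icc (0 : ℝ) T, ∀ x, Tendsto (fun N => gs i (φ N) t x) atTop (nhds (G i t x)) := by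
  induction S using Finset.induction_on with
  | empty => exact ⟨id, strictMono_id, fun _ _ _ => 0, by simp⟩
  | insert i S hi ih =>
    obtain ⟨φ, hφ, G, hG⟩ := ih fun j hj => h j (Finset.mem_insert_of_mem hj)
    obtain ⟨ψ, hψ, G', hG'⟩ := AnisoBound.exists_subseq (gs := fun N => gs i (φ N))
      (fun N => h i (Finset.mem_insert_self _ _) (φ N)) hT hlam (hd i)
    refine ⟨φ ∘ ψ, hφ.comp hψ, Function.update G i G', fun j hj t ht x => ?_⟩
    by_cases hji : j = i
    · subst hji
      simpa using hG' t ht x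
    · rw [Function.update_of_ne hji]
      exact (hG j ((Finset.mem_insert.1 hj).resolve_left hji) t ht x).comp hψ.tendsto_atTop

instance instProperSpaceMultilinear (m : ℕ) :
    ProperSpace (ContinuousMultilinearMap ℝ (fun _ : Fin m => Spc n) ℝ) := by
  have : FiniteDimensional ℝ (ContinuousMultilinearMap ℝ (fun _ : Fin m => Spc n) ℝ) :=
    Module.Finite.of_injective
      (ContinuousMultilinearMap.toMultilinearMapLinear (R' := ℝ) (A := ℝ)
        (M₁ := fun _ : Fin m => Spc n) (M₂ := ℝ))
      ContinuousMultilinearMap.toMultilinearMap_injective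
  exact FiniteDimensional.proper ℝ _

/-- The bound `C` for all constituents of the norm of `C^{k,𝐬(s,λ,δ)}_T`. -/
def KSBound (T : ℝ) (k s : ℕ) (lam δ C : ℝ) (u : ℝ → Spc n → ℝ) : Prop :=
  ∀ j p : ℕ, j ≤ s → p + 2 * j ≤ 2 * s + k →
    AnisoBound T lam (δ + p) C (mixDeriv T p j u)

lemma KSBound.of_eAnisoKS_le {T : ℝ} {k s : ℕ} {lam δ C : ℝ} {u : ℝ → Spc n → ℝ} (hC : 0 ≤ C)
    (h : eAnisoKS T k s lam δ u ≤ ENNReal.ofReal C) : KSBound T k s lam δ C u := by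
  intro j p hj hp
  obtain ⟨b, m, rfl, hb, hm⟩ : ∃ b m : ℕ, b + m = p ∧ b ≤ k ∧ m + 2 * j ≤ 2 * s :=
    ⟨p - min p (2 * s - 2 * j), min p (2 * s - 2 * j), by omega, by omega, by omega⟩
  refine AnisoBound.of_eAniso0_le hC (le_trans ?_ h)
  unfold eAnisoKS
  refine le_trans ?_ (Finset.single_le_sum (f := fun b : ℕ => ∑ m ∈ Finset.range (2 * s + 1),
    ∑ j ∈ Finset.range (s + 1), if m + 2 * j ≤ 2 * s then
      eAniso0 T lam (δ + b + m) (mixDeriv T (b + m) j u) else 0)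
    (fun _ _ => zero_le) (Finset.mem_range.2 (by omega : b < k + 1)))
  refine le_trans ?_ (Finset.single_le_sum (f := fun m : ℕ =>
    ∑ j ∈ Finset.range (s + 1), if m + 2 * j ≤ 2 * s then
      eAniso0 T lam (δ + b + m) (mixDeriv T (b + m) j u) else 0)
    (fun _ _ => zero_le) (Finset.mem_range.2 (by omega : m < 2 * s + 1)))
  refine le_trans ?_ (Finset.single_le_sum (f := fun j : ℕ =>
    if m + 2 * j ≤ 2 * s then eAniso0 T lam (δ + b + m) (mixDeriv T (b + m) j u) else 0)
    (fun _ _ => zero_le) (Finset.mem_range.2 (by omega : j < s + 1)))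
  rw [if_pos hm, Nat.cast_add, add_assoc]

lemma KSBound.eAnisoKS_le {T : ℝ} {k s : ℕ} {lam δ C : ℝ} {u : ℝ → Spc n → ℝ}
    (h : KSBound T k s lam δ C u) (hT : 0 < T) (hδ : 0 ≤ δ) :
    eAnisoKS T k s lam δ u ≤
      ((k + 1) * ((2 * s + 1) * (s + 1)) : ℕ) * ENNReal.ofReal (5 * C) := by
  have hterm : ∀ b ∈ Finset.range (k + 1), ∀ m ∈ Finset.range (2 * s + 1),
      ∀ j ∈ Finset.range (s + 1), (if m + 2 * j ≤ 2 * s then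
        eAniso0 T lam (δ + b + m) (mixDeriv T (b + m) j u) else 0) ≤ ENNReal.ofReal (5 * C) := by
    intro b hb m _ j hj
    split_ifs with hm
    · rw [Finset.mem_range] at hb hj
      have h1 := h j (b + m) (by omega) (by omega)
      rw [Nat.cast_add, ← add_assoc] at h1
      exact eAniso0_le h1 hT (by positivity)
    · exact zero_le
  unfold eAnisoKS
  calc _ ≤ ∑ b ∈ Finset.range (k + 1), ∑ m ∈ Finset.range (2 * s + 1),
        ∑ j ∈ Finset.range (s + 1), ENNReal.ofReal (5 * C) :=
      Finset.sum_le_sum fun b hb => Finset.sum_le_sum fun m hm => Finset.sum_le_sum fun j hj =>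
        hterm b hb m hm j hj
    _ = _ := by
      simp only [Finset.sum_const, Finset.card_range, nsmul_eq_mul]
      push_cast
      ring

lemma KSBound.weaken {T : ℝ} {k s s' : ℕ} {lam δ C : ℝ} {u : ℝ → Spc n → ℝ}
    (h : KSBound T k s lam δ C u) (hs : s' ≤ s) : KSBound T k s' 0 δ C u :=
  fun j p hj hp => (h j p (hj.trans hs) (by omega)).to_zero

section regularity

variable {T : ℝ} {k s : ℕ} {u v : ℝ → Spc n → ℝ}

lemma withTop_order_eq {j : ℕ} :
    (2 * ((s : WithTop ℕ∞) - j) + k : WithTop ℕ∞) = ((2 * (s - j) + k : ℕ) : WithTop ℕ∞) := by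
  push_cast
  rfl

lemma AnisoReg.contDiff_tDeriv (h : AnisoReg T k s u) {j p : ℕ} (hj : j ≤ s)
    (hp : p + 2 * j ≤ 2 * s + k) {t : ℝ} (ht : t ∈ Set.Icc (0 : ℝ) T) :
    ContDiff ℝ p (tDeriv T j u t) := by
  have h1 := h.2.1 j hj t ht
  rw [withTop_order_eq] at h1
  exact h1.of_le (by exact_mod_cast (by omega : p ≤ 2 * (s - j) + k))

lemma AnisoReg.weaken (h : AnisoReg T k s u) {s' : ℕ} (hs : s' ≤ s) : AnisoReg T k s' u := by
  refine ⟨fun x => (h.1 x).of_le (by exact_mod_cast hs), fun j hj t ht => ?_,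
    fun j m hj hm => h.2.2 j m (hj.trans hs) (by omega)⟩
  rw [withTop_order_eq]
  exact h.contDiff_tDeriv (hj.trans hs) (by omega) ht

lemma AnisoReg.tDeriv_sub (hT : 0 < T) (hu : AnisoReg T k s u) (hv : AnisoReg T k s v) {j : ℕ}
    (hj : j ≤ s) {t : ℝ} (ht : t ∈ Set.Icc (0 : ℝ) T) :
    tDeriv T j (u - v) t = tDeriv T j u t - tDeriv T j v t := by
  funext x
  exact iteratedDerivWithin_sub (f := fun τ => u τ x) (g := fun τ => v τ x) ht
    (uniqueDiffOn_Icc hT) ((hu.1 x t ht).of_le (by exact_mod_cast hj))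
    ((hv.1 x t ht).of_le (by exact_mod_cast hj))

lemma AnisoReg.mixDeriv_sub (hT : 0 < T) (hu : AnisoReg T k s u) (hv : AnisoReg T k s v)
    {j p : ℕ} (hj : j ≤ s) (hp : p + 2 * j ≤ 2 * s + k) {t : ℝ} (ht : t ∈ Set.Icc (0 : ℝ) T)
    (x : Spc n) :
    mixDeriv T p j (u - v) t x = mixDeriv T p j u t x - mixDeriv T p j v t x := by
  change iteratedFDeriv ℝ p (tDeriv T j (u - v) t) x = _
  rw [AnisoReg.tDeriv_sub hT hu hv hj ht, iteratedFDeriv_sub (hu.contDiff_tDeriv hj hp ht)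
    (hv.contDiff_tDeriv hj hp ht)]
  rfl

lemma AnisoReg.sub (hT : 0 < T) (hu : AnisoReg T k s u) (hv : AnisoReg T k s v) :
    AnisoReg T k s (u - v) := by
  refine ⟨fun x => (hu.1 x).sub (hv.1 x), fun j hj t ht => ?_, fun j m hj hm => ?_⟩
  · change ContDiff ℝ _ (tDeriv T j (u - v) t)
    rw [AnisoReg.tDeriv_sub hT hu hv hj ht]
    exact (hu.2.1 j hj t ht).sub (hv.2.1 j hj t ht)
  · refine ((hu.2.2 j m hj hm).sub (hv.2.2 j m hj hm)).congr fun p => ?_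
    exact (AnisoReg.mixDeriv_sub hT hu hv hj hm p.1.2 p.2).symm

end regularity

/-! ### Compactness -/

/-- The sequence `u` has a subsequence which converges in `C^{k,𝐬(s,λ,δ)}_T`. -/
def HasConvSubseq (T : ℝ) (k s : ℕ) (lam δ : ℝ) (u : ℕ → ℝ → Spc n → ℝ) : Prop :=
  ∃ φ : ℕ → ℕ, StrictMono φ ∧ ∃ v : ℝ → Spc n → ℝ, AnisoReg T k s v ∧
    (∃ C, KSBound T k s lam δ C v) ∧
    ∀ ε > 0, ∀ᶠ N in atTop, KSBound T k s lam δ ε (u (φ N) - v)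

section compactness

variable {T : ℝ} {k s : ℕ}

lemma KSBound.interp {lam δ C lam' δ' : ℝ} {u : ℝ → Spc n → ℝ} (h : KSBound T k s lam δ C u)
    (hT : 0 < T) (hlam' : 0 ≤ lam') (hl : lam' < lam) (hδ' : 0 ≤ δ') (hδ : δ' ≤ δ) :
    ∃ C', KSBound T k s lam' δ' C' u := by
  have hθ : 0 ≤ 1 - lam' / lam := sub_nonneg.2 ((div_le_one (hlam'.trans_lt hl)).2 hl.le)
  refine ⟨C + C ^ (lam' / lam) * (2 * 2 ^ (δ' + (2 * s + k : ℕ)) * C) ^ (1 - lam' / lam),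
    fun j p hj hp => ?_⟩
  have hjp := h j p hj hp
  have hC := hjp.nonneg hT
  have hpk : (p : ℝ) ≤ (2 * s + k : ℕ) := by exact_mod_cast (by omega : p ≤ 2 * s + k)
  refine (hjp.interp hT hlam' hl (by positivity) (by linarith)
    (fun t ht x => le_trans ?_ (hjp.sup t ht x))).mono ?_
  · gcongr
    exact one_le_wt x
  · gcongr
    norm_num

lemma tendstoUniformly_of_eventually_norm_sub_le {ι α F : Type*} [NormedAddCommGroup F]
    {l : Filter ι} {f : ι → α → F} {g : α → F}
    (h : ∀ η > 0, ∀ᶠ N in l, ∀ x, ‖f N x - g x‖ ≤ η) : TendstoUniformly f g l := by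
  rw [Metric.tendstoUniformly_iff]
  intro ε hε
  filter_upwards [h (ε / 2) (half_pos hε)] with N hN x
  rw [dist_comm, dist_eq_norm]
  linarith [hN x]

/-- If all mixed derivatives converge pointwise and are bounded in the norm with weight `δ` and
exponent `λ > 0`, then the limits are the mixed derivatives of the limit. -/
lemma exists_limit_of_tendsto {lam δ C : ℝ} (hT : 0 < T) (hlam : 0 < lam) (hδ : 0 < δ)
    {u : ℕ → ℝ → Spc n → ℝ} (hreg : ∀ N, AnisoReg T k s (u N))
    (hb : ∀ N, KSBound T k s lam δ C (u N))
    {G : ∀ i : ℕ × ℕ, ℝ → Spc n → ContinuousMultilinearMap ℝ (fun _ : Fin i.2 => Spc n) ℝ}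
    (hG : ∀ j p : ℕ, j ≤ s → p + 2 * j ≤ 2 * s + k → ∀ t ∈ Set.Icc (0 : ℝ) T, ∀ x,
      Tendsto (fun N => mixDeriv T p j (u N) t x) atTop (nhds (G (j, p) t x))) :
    ∃ v : ℝ → Spc n → ℝ, AnisoReg T k s v ∧ ∀ j p : ℕ, j ≤ s → p + 2 * j ≤ 2 * s + k →
      ∀ t ∈ Set.Icc (0 : ℝ) T, ∀ x, mixDeriv T p j v t x = G (j, p) t x := by
  have hGb : ∀ j p : ℕ, j ≤ s → p + 2 * j ≤ 2 * s + k →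
      AnisoBound T lam (δ + p) C (G (j, p)) := fun j p hj hp =>
    AnisoBound.of_tendsto (fun N => hb N j p hj hp) (hG j p hj hp)
  have hunif : ∀ j p : ℕ, j ≤ s → p + 2 * j ≤ 2 * s + k → ∀ η > 0, ∀ᶠ N in atTop,
      ∀ t ∈ Set.Icc (0 : ℝ) T, ∀ x, ‖mixDeriv T p j (u N) t x - G (j, p) t x‖ ≤ η := by
    intro j p hj hp η hη
    have h1 := AnisoBound.eventually_sup_le (d' := 0)
      (fun N => (hb N j p hj hp).sub (hGb j p hj hp)) hlam le_rfl (by positivity)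
      (fun t ht x => by
        have h2 := (hG j p hj hp t ht x).sub_const (G (j, p) t x)
        rwa [sub_self] at h2) hη
    filter_upwards [h1] with N hN t ht x
    simpa using hN t ht x
  let v : ℝ → Spc n → ℝ := fun t x => (G (0, 0) t x).curry0
  have htime : ∀ x, ContDiffOn ℝ s (fun t => v t x) (Set.Icc 0 T) ∧ ∀ j ≤ s,
      Set.EqOn (iteratedDerivWithin j (fun t => v t x) (Set.Icc 0 T))
        (fun t => (G (j, 0) t x).curry0) (Set.Icc 0 T) := by
    intro x
    refine contDiffOn_Icc_of_tendstoUniformlyOn hT (f := fun N t => u N t x)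
      (g := fun j t => (G (j, 0) t x).curry0) (fun N => (hreg N).1 x) fun j hj => ?_
    rw [Metric.tendstoUniformlyOn_iff]
    intro ε hε
    filter_upwards [hunif j 0 hj (by omega) (ε / 2) (half_pos hε)] with N hN t ht
    rw [dist_comm, dist_eq_norm]
    have h1 : iteratedDerivWithin j (fun t => u N t x) (Set.Icc 0 T) t - (G (j, 0) t x).curry0 =
        (mixDeriv T 0 j (u N) t x - G (j, 0) t x) 0 := by
      rfl
    rw [h1]
    have h2 := (mixDeriv T 0 j (u N) t x - G (j, 0) t x).le_opNorm 0
    have h3 := hN t ht x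
    simp only [Finset.univ_eq_empty, Finset.prod_empty, mul_one] at h2
    linarith
  have htd : ∀ j ≤ s, ∀ t ∈ Set.Icc (0 : ℝ) T,
      tDeriv T j v t = fun x => (G (j, 0) t x).curry0 := fun j hj t ht =>
    funext fun x => (htime x).2 j hj ht
  have htaylor : ∀ j ≤ s, ∀ t ∈ Set.Icc (0 : ℝ) T,
      HasFTaylorSeriesUpTo (2 * (s - j) + k : ℕ) (tDeriv T j v t) (fun x p => G (j, p) t x) := by
    intro j hj t ht
    rw [htd j hj t ht]
    exact hasFTaylorSeriesUpTo_of_tendstoUniformly (f := fun N => tDeriv T j (u N) t)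
      (G := fun x p => G (j, p) t x)
      (fun N => (hreg N).contDiff_tDeriv hj (by omega) ht) fun p hp =>
        tendstoUniformly_of_eventually_norm_sub_le fun η hη => by
          filter_upwards [hunif j p hj (by omega) η hη] with N hN x using hN t ht x
  have hmix : ∀ j p : ℕ, j ≤ s → p + 2 * j ≤ 2 * s + k →
      ∀ t ∈ Set.Icc (0 : ℝ) T, ∀ x, mixDeriv T p j v t x = G (j, p) t x := by
    intro j p hj hp t ht x
    exact ((htaylor j hj t ht).eq_iteratedFDeriv
      (by exact_mod_cast (by omega : p ≤ 2 * (s - j) + k)) x).symm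
  refine ⟨v, ⟨fun x => (htime x).1, fun j hj t ht => ?_, fun j p hj hp => ?_⟩, hmix⟩
  · rw [withTop_order_eq]
    exact (htaylor j hj t ht).contDiff
  · exact ((hGb j p hj hp).continuous hlam (by positivity)).congr fun q =>
      (hmix j p hj hp q.1 q.1.2 q.2).symm

lemma hasConvSubseq_of_lam_lt {lam δ C lam' δ' : ℝ} (hT : 0 < T) (hlam' : 0 ≤ lam')
    (hl : lam' < lam) (hδ' : 0 ≤ δ') (hδ : δ' < δ) {u : ℕ → ℝ → Spc n → ℝ}
    (hreg : ∀ N, AnisoReg T k s (u N)) (hb : ∀ N, KSBound T k s lam δ C (u N)) :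
    HasConvSubseq T k s lam' δ' u := by
  have hδ0 : 0 < δ := hδ'.trans_lt hδ
  have hlam : 0 < lam := hlam'.trans_lt hl
  let S : Finset (ℕ × ℕ) := (Finset.range (s + 1) ×ˢ Finset.range (2 * s + k + 1)).filter
    fun i => i.2 + 2 * i.1 ≤ 2 * s + k
  have hS : ∀ j p : ℕ, (j, p) ∈ S ↔ j ≤ s ∧ p + 2 * j ≤ 2 * s + k := by
    intro j p
    simp only [S, Finset.mem_filter, Finset.mem_product, Finset.mem_range]
    omega
  obtain ⟨φ, hφ, G, hG⟩ := exists_common_subseq S (d := fun i : ℕ × ℕ => δ + i.2)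
    (F := fun i => ContinuousMultilinearMap ℝ (fun _ : Fin i.2 => Spc n) ℝ) hT hlam
    (fun i => by positivity) (fun i N => mixDeriv T i.2 i.1 (u N))
    (fun i hi N => hb N i.1 i.2 ((hS _ _).1 hi).1 ((hS _ _).1 hi).2)
  have hG' : ∀ j p : ℕ, j ≤ s → p + 2 * j ≤ 2 * s + k → ∀ t ∈ Set.Icc (0 : ℝ) T, ∀ x,
      Tendsto (fun N => mixDeriv T p j (u (φ N)) t x) atTop (nhds (G (j, p) t x)) :=
    fun j p hj hp => hG (j, p) ((hS j p).2 ⟨hj, hp⟩)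
  obtain ⟨v, hv, hmix⟩ := exists_limit_of_tendsto hT hlam hδ0 (fun N => hreg (φ N))
    (fun N => hb (φ N)) hG'
  have hvb : KSBound T k s lam δ C v := fun j p hj hp =>
    AnisoBound.of_tendsto (fun N => hb (φ N) j p hj hp) fun t ht x => by
      rw [hmix j p hj hp t ht x]
      exact hG' j p hj hp t ht x
  refine ⟨φ, hφ, v, hv, hvb.interp hT hlam' hl hδ' hδ.le, fun ε hε => ?_⟩
  have h1 : ∀ i ∈ S, ∀ᶠ N in atTop,
      AnisoBound T lam' (δ' + i.2) ε (mixDeriv T i.2 i.1 (u (φ N) - v)) := by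
    rintro ⟨j, p⟩ hi
    obtain ⟨hj, hp⟩ := (hS j p).1 hi
    have h2 := AnisoBound.eventually_of_tendsto (d' := δ' + p)
      (fun N => (hb (φ N) j p hj hp).sub (hvb j p hj hp)) hT hlam' hl (by positivity)
      (by linarith) (fun t ht x => by
        have h3 := (hG' j p hj hp t ht x).sub_const (G (j, p) t x)
        rwa [sub_self, ← hmix j p hj hp t ht x] at h3) hε
    filter_upwards [h2] with N hN
    exact hN.congr fun t ht x => AnisoReg.mixDeriv_sub hT (hreg (φ N)) hv hj hp ht x
  filter_upwards [(Finset.eventually_all S).2 h1] with N hN j p hj hp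
  exact hN (j, p) ((hS j p).2 ⟨hj, hp⟩)

end compactness

/-! ### Embeddings with a loss of order -/

lemma intervalIntegral_curryLeft {E F : Type*} [NormedAddCommGroup E] [NormedSpace ℝ E]
    [NormedAddCommGroup F] [NormedSpace ℝ F] [CompleteSpace F] {p : ℕ} {a b : ℝ}
    {f : ℝ → ContinuousMultilinearMap ℝ (fun _ : Fin (p + 1) => E) F}
    (hf : IntervalIntegrable f volume a b) :
    ∫ τ in a..b, (f τ).curryLeft = (∫ τ in a..b, f τ).curryLeft := by
  let L := (continuousMultilinearCurryLeftEquiv ℝ (fun _ : Fin (p + 1) => E)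
    F).toContinuousLinearEquiv.toContinuousLinearMap
  exact ContinuousLinearMap.intervalIntegral_comp_comm (𝕜 := ℝ)
    (E := ContinuousMultilinearMap ℝ (fun _ : Fin (p + 1) => E) F)
    (F := E →L[ℝ] ContinuousMultilinearMap ℝ (fun _ : Fin p => E) F) L hf

section embedding

variable {T : ℝ} {k s : ℕ} {u : ℝ → Spc n → ℝ}

lemma AnisoReg.hasFDerivAt_mixDeriv (h : AnisoReg T k s u) {j p : ℕ} (hj : j ≤ s)
    (hp : p + 1 + 2 * j ≤ 2 * s + k) {t : ℝ} (ht : t ∈ Set.Icc (0 : ℝ) T) (x : Spc n) :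
    HasFDerivAt (mixDeriv T p j u t) (mixDeriv T (p + 1) j u t x).curryLeft x :=
  (h.contDiff_tDeriv hj hp ht).ftaylorSeries.fderiv p (by exact_mod_cast p.lt_succ_self) x

lemma AnisoReg.continuousOn_mixDeriv (h : AnisoReg T k s u) {j p : ℕ} (hj : j ≤ s)
    (hp : p + 2 * j ≤ 2 * s + k) (x : Spc n) :
    ContinuousOn (fun τ => mixDeriv T p j u τ x) (Set.Icc 0 T) := by
  rw [continuousOn_iff_continuous_domRestrict]
  exact (h.2.2 j p hj hp).comp (continuous_id.prodMk continuous_const)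

lemma AnisoReg.intervalIntegrable_mixDeriv (h : AnisoReg T k s u) {j p : ℕ} (hj : j ≤ s)
    (hp : p + 2 * j ≤ 2 * s + k) (x : Spc n) {a b : ℝ} (ha : 0 ≤ a) (hab : a ≤ b) (hb : b ≤ T) :
    IntervalIntegrable (fun τ => mixDeriv T p j u τ x) volume a b :=
  ((h.continuousOn_mixDeriv hj hp x).mono (by
    rw [Set.uIcc_of_le hab]
    exact Set.Icc_subset_Icc ha hb)).intervalIntegrable

lemma AnisoReg.integral_mixDeriv (hT : 0 < T) (h : AnisoReg T k (s + 1) u) {C : ℝ}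
    (hC : ∀ j p : ℕ, j ≤ s + 1 → p + 2 * j ≤ 2 * (s + 1) + k → ∀ t ∈ Set.Icc (0 : ℝ) T, ∀ x,
      ‖mixDeriv T p j u t x‖ ≤ C)
    {j p : ℕ} (hj : j ≤ s) (hp : p + 2 * j ≤ 2 * s + k) {a b : ℝ} (ha : 0 ≤ a) (hab : a ≤ b)
    (hb : b ≤ T) (x : Spc n) :
    ∫ τ in a..b, mixDeriv T p (j + 1) u τ x = mixDeriv T p j u b x - mixDeriv T p j u a x := by
  induction p generalizing x with
  | zero =>
    have hint := h.intervalIntegrable_mixDeriv (j := j + 1) (p := 0) (by omega) (by omega) x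
      ha hab hb
    ext m
    have h1 := ((ContinuousMultilinearMap.apply ℝ (fun _ : Fin 0 => Spc n) ℝ
      m).intervalIntegral_comp_comm hint)
    have h2 := integral_iteratedDerivWithin_Icc hT (h.1 x) (Nat.lt_succ_of_le hj) ha hab hb
    exact h1.symm.trans h2
  | succ p ih =>
    have hIcc : ∀ τ ∈ Set.uIoc a b, τ ∈ Set.Icc 0 T := fun τ hτ => by
      rw [Set.uIoc_of_le hab] at hτ
      exact ⟨ha.trans hτ.1.le, hτ.2.trans hb⟩
    let L := continuousMultilinearCurryLeftEquiv ℝ (fun _ : Fin (p + 1) => Spc n) ℝ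
    have hint := fun y => h.intervalIntegrable_mixDeriv (j := j + 1) (p := p) (by omega)
      (by omega) y ha hab hb
    have hint' := h.intervalIntegrable_mixDeriv (j := j + 1) (p := p + 1) (by omega)
      (by omega) x ha hab hb
    have h1 : HasFDerivAt (fun y => ∫ τ in a..b, mixDeriv T p (j + 1) u τ y)
        (∫ τ in a..b, (mixDeriv T (p + 1) (j + 1) u τ x).curryLeft) x := by
      refine intervalIntegral.hasFDerivAt_integral_of_dominated_of_fderiv_le (s := Set.univ)
        (F := fun y τ => mixDeriv T p (j + 1) u τ y)
        (F' := fun y τ => (mixDeriv T (p + 1) (j + 1) u τ y).curryLeft) (bound := fun _ => C)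
        univ_mem (Eventually.of_forall fun y => ?_) (hint x) ?_ ?_ intervalIntegrable_const ?_
      · exact (intervalIntegrable_iff.1 (hint y)).aestronglyMeasurable
      · exact L.continuous.comp_aestronglyMeasurable
          (intervalIntegrable_iff.1 hint').aestronglyMeasurable
      · refine Eventually.of_forall fun τ hτ y _ => ?_
        change ‖continuousMultilinearCurryLeftEquiv ℝ (fun _ : Fin (p + 1) => Spc n) ℝ _‖ ≤ C
        rw [LinearIsometryEquiv.norm_map]
        exact hC _ _ (by omega) (by omega) τ (hIcc τ hτ) y
      · exact Eventually.of_forall fun τ hτ y _ =>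
          h.hasFDerivAt_mixDeriv (by omega) (by omega) (hIcc τ hτ) y
    rw [funext fun y => ih (by omega) y] at h1
    have h2 := h1.unique
      ((h.hasFDerivAt_mixDeriv (by omega) (by omega) ⟨ha.trans hab, hb⟩ x).sub
        (h.hasFDerivAt_mixDeriv (by omega) (by omega) ⟨ha, hab.trans hb⟩ x))
    exact L.injective (((intervalIntegral_curryLeft hint').symm.trans h2).trans (L.map_sub _ _).symm)

/-- The space `C^{k,𝐬(s+1,0,δ)}_T` embeds into `C^{k,𝐬(s,1,δ)}_T`. -/
lemma KSBound.of_succ {δ C : ℝ} (h : KSBound T k (s + 1) 0 δ C u) (hreg : AnisoReg T k (s + 1) u)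
    (hT : 0 < T) (hδ : 0 ≤ δ) :
    KSBound T k s 1 δ ((4 ^ (δ + (2 * s + k : ℕ) + 1) + T ^ (1 / 2 : ℝ)) * C) u := by
  intro j p hj hp
  set K : ℝ := 4 ^ (δ + (2 * s + k : ℕ) + 1)
  have hp0 := h j p (by omega) (by omega)
  have hp1 := h j (p + 1) (by omega) (by omega)
  have hC := hp0.nonneg hT
  have hK : 1 ≤ K := Real.one_le_rpow (by norm_num) (by positivity)
  have hT2 : 0 ≤ T ^ (1 / 2 : ℝ) := by positivity
  have hpk : (p : ℝ) ≤ (2 * s + k : ℕ) := by exact_mod_cast (by omega : p ≤ 2 * s + k)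
  have hmv : ∀ t ∈ Set.Icc (0 : ℝ) T, ∀ (x y : Spc n) (M : ℝ),
      (∀ z ∈ segment ℝ x y, ‖mixDeriv T (p + 1) j u t z‖ ≤ M) →
      ‖mixDeriv T p j u t x - mixDeriv T p j u t y‖ ≤ M * ‖x - y‖ := by
    intro t ht x y M hM
    refine (convex_segment x y).norm_image_sub_le_of_norm_hasFDerivWithin_le
      (fun z _ => (hreg.hasFDerivAt_mixDeriv (by omega) (by omega) ht z).hasFDerivWithinAt)
      (fun z hz => ?_) (right_mem_segment _ _ _) (left_mem_segment _ _ _)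
    change ‖continuousMultilinearCurryLeftEquiv ℝ (fun _ : Fin (p + 1) => Spc n) ℝ _‖ ≤ M
    rw [LinearIsometryEquiv.norm_map]
    exact hM z hz
  have hbound : ∀ r : ℝ, 0 ≤ r → C * r ≤ (K + T ^ (1 / 2 : ℝ)) * C * r := fun r hr => by
    have : C ≤ (K + T ^ (1 / 2 : ℝ)) * C := le_mul_of_one_le_left hC (by linarith)
    gcongr
  constructor
  · intro t ht x
    have := hbound 1 zero_le_one
    linarith [hp0.sup t ht x]
  · intro _ t ht x y _ _
    rw [Real.rpow_one]
    exact (hmv t ht x y C fun z _ => hp1.norm_le (by positivity) ht z).trans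
      (hbound _ (norm_nonneg _))
  · intro _ t ht x y hxy
    rw [Real.rpow_one]
    have he : 0 ≤ δ + p + 1 := by positivity
    have hw := wt2_pos x y
    have hseg : ∀ z ∈ segment ℝ x y, wt2 x y ≤ 4 * wt z := by
      intro z hz
      have hz1 : ‖x - z‖ ≤ ‖x‖ / 2 := by
        refine le_trans ?_ hxy
        rw [norm_sub_rev x z, norm_sub_rev x y]
        exact norm_sub_le_of_mem_segment hz
      linarith [(wt2_le_of_near hxy).1, (wt_le_two_mul_of_near hz1).1]
    have hW : 0 < wt2 x y ^ (δ + p + 1) := Real.rpow_pos_of_pos hw _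
    have h1 := hmv t ht x y (4 ^ (δ + p + 1) * C / wt2 x y ^ (δ + p + 1)) fun z hz => by
      rw [le_div_iff₀ hW]
      have h2 := hp1.sup t ht z
      rw [Nat.cast_add, Nat.cast_one, ← add_assoc] at h2
      calc ‖mixDeriv T (p + 1) j u t z‖ * wt2 x y ^ (δ + p + 1)
          ≤ ‖mixDeriv T (p + 1) j u t z‖ * (4 * wt z) ^ (δ + p + 1) := by
            gcongr
            exact hseg z hz
        _ = 4 ^ (δ + p + 1) * (wt z ^ (δ + p + 1) * ‖mixDeriv T (p + 1) j u t z‖) := by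
            rw [Real.mul_rpow (by norm_num) (wt_pos z).le]
            ring
        _ ≤ 4 ^ (δ + p + 1) * C := by gcongr
    calc wt2 x y ^ (δ + p + 1) * ‖mixDeriv T p j u t x - mixDeriv T p j u t y‖
        ≤ wt2 x y ^ (δ + p + 1) *
          (4 ^ (δ + p + 1) * C / wt2 x y ^ (δ + p + 1) * ‖x - y‖) := by gcongr
      _ = 4 ^ (δ + p + 1) * C * ‖x - y‖ := by field_simp
      _ ≤ (K + T ^ (1 / 2 : ℝ)) * C * ‖x - y‖ := by
        have h3 : (4 : ℝ) ^ (δ + p + 1) ≤ K :=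
          Real.rpow_le_rpow_of_exponent_le (by norm_num) (by linarith)
        have h4 : (4 : ℝ) ^ (δ + p + 1) ≤ K + T ^ (1 / 2 : ℝ) := by linarith
        gcongr
  · intro _ t₁ ht₁ t₂ ht₂ x
    wlog hle : t₁ ≤ t₂ generalizing t₁ t₂
    · rw [norm_sub_rev, abs_sub_comm]
      exact this t₂ ht₂ t₁ ht₁ (le_of_not_ge hle)
    have hd : 0 ≤ δ + (p : ℝ) := by positivity
    have hW : 0 < wt x ^ (δ + p) := Real.rpow_pos_of_pos (wt_pos x) _
    have hp2 := h (j + 1) p (by omega) (by omega)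
    have h1 := hreg.integral_mixDeriv hT (C := C) (fun j p hj hp t ht x =>
      (h j p hj hp).norm_le (by positivity) ht x) hj hp ht₁.1 hle ht₂.2 x
    have h2 : ‖∫ τ in t₁..t₂, mixDeriv T p (j + 1) u τ x‖ ≤
        C / wt x ^ (δ + p) * |t₂ - t₁| := by
      refine intervalIntegral.norm_integral_le_of_norm_le_const fun τ hτ => ?_
      rw [Set.uIoc_of_le hle] at hτ
      rw [le_div_iff₀' hW]
      exact hp2.sup τ ⟨ht₁.1.trans hτ.1.le, hτ.2.trans ht₂.2⟩ x
    rw [h1, norm_sub_rev, abs_sub_comm] at h2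
    have h3 : |t₁ - t₂| ≤ T ^ (1 / 2 : ℝ) * |t₁ - t₂| ^ (1 / 2 : ℝ) := by
      have h4 : |t₁ - t₂| ≤ T := by
        rw [abs_le]
        constructor <;> linarith [ht₁.1, ht₁.2, ht₂.1, ht₂.2]
      calc |t₁ - t₂| = |t₁ - t₂| ^ (1 / 2 : ℝ) * |t₁ - t₂| ^ (1 / 2 : ℝ) := by
            rw [← Real.sqrt_eq_rpow, Real.mul_self_sqrt (abs_nonneg _)]
        _ ≤ _ := by gcongr
    calc wt x ^ (δ + p) * ‖mixDeriv T p j u t₁ x - mixDeriv T p j u t₂ x‖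
        ≤ wt x ^ (δ + p) * (C / wt x ^ (δ + p) * |t₁ - t₂|) := by gcongr
      _ = C * |t₁ - t₂| := by field_simp
      _ ≤ C * (T ^ (1 / 2 : ℝ) * |t₁ - t₂| ^ (1 / 2 : ℝ)) := by gcongr
      _ ≤ (K + T ^ (1 / 2 : ℝ)) * C * |t₁ - t₂| ^ (1 / 2 : ℝ) := by
        have h5 : T ^ (1 / 2 : ℝ) ≤ K + T ^ (1 / 2 : ℝ) := by linarith
        calc _ = T ^ (1 / 2 : ℝ) * C * |t₁ - t₂| ^ (1 / 2 : ℝ) := by ring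
          _ ≤ _ := by gcongr

lemma HasConvSubseq.of_succ {δ : ℝ} {u : ℕ → ℝ → Spc n → ℝ}
    (h : HasConvSubseq T k (s + 1) 0 δ u) (hreg : ∀ N, AnisoReg T k (s + 1) (u N)) (hT : 0 < T)
    (hδ : 0 ≤ δ) : HasConvSubseq T k s 1 δ u := by
  obtain ⟨φ, hφ, v, hv, ⟨C, hC⟩, hlim⟩ := h
  refine ⟨φ, hφ, v, hv.weaken s.le_succ, ⟨_, hC.of_succ hv hT hδ⟩, fun ε hε => ?_⟩
  set K : ℝ := 4 ^ (δ + (2 * s + k : ℕ) + 1) + T ^ (1 / 2 : ℝ)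
  have hK : 0 < K := by positivity
  filter_upwards [hlim (ε / K) (div_pos hε hK)] with N hN
  have h1 := hN.of_succ (AnisoReg.sub hT (hreg (φ N)) hv) hT hδ
  rwa [mul_div_cancel₀ _ hK.ne'] at h1

end embedding

/-- Boundedness in `C^{k,𝐬(s,λ,δ)}_T` yields convergent subsequences in every space
`C^{k,𝐬(s',λ',δ')}_T` of lower order and lower weight. -/
lemma hasConvSubseq_of_order_lt {T : ℝ} {k s s' : ℕ} {lam lam' δ δ' C : ℝ} (hT : 0 < T)
    (hδ' : 0 ≤ δ') (hδ : δ' < δ) (hlam : lam ∈ Set.Icc (0 : ℝ) 1)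
    (hlam' : lam' ∈ Set.Icc (0 : ℝ) 1) (hord : (s' : ℝ) + lam' < (s : ℝ) + lam)
    {u : ℕ → ℝ → Spc n → ℝ} (hreg : ∀ N, AnisoReg T k s (u N))
    (hb : ∀ N, KSBound T k s lam δ C (u N)) : HasConvSubseq T k s' lam' δ' u := by
  have hδ0 : 0 ≤ δ := hδ'.trans hδ.le
  have hsub_one : ∀ lam'' : ℝ, ∀ r' : ℕ, r' < s → 0 ≤ lam'' → lam'' < 1 →
      HasConvSubseq T k r' lam'' δ' u := fun lam'' r' hr h0 h1 =>
    hasConvSubseq_of_lam_lt hT h0 h1 hδ' hδ (fun N => (hreg N).weaken hr.le) fun N =>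
      ((hb N).weaken (Nat.succ_le_of_lt hr)).of_succ ((hreg N).weaken (Nat.succ_le_of_lt hr)) hT hδ0
  have hss : s' ≤ s := by
    by_contra! hlt
    have : (s : ℝ) + 1 ≤ s' := by exact_mod_cast hlt
    linarith [hlam.2, hlam'.1]
  rcases hss.eq_or_lt with rfl | hlt
  · exact hasConvSubseq_of_lam_lt hT hlam'.1 (by linarith) hδ' hδ hreg hb
  rcases hlam'.2.eq_or_lt with rfl | hlt1
  · refine HasConvSubseq.of_succ ?_ (fun N => (hreg N).weaken (Nat.succ_le_of_lt hlt)) hT hδ'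
    rcases (Nat.succ_le_of_lt hlt).eq_or_lt with rfl | hlt2
    · refine hasConvSubseq_of_lam_lt hT le_rfl ?_ hδ' hδ hreg hb
      push_cast at hord
      linarith
    · exact hsub_one 0 _ hlt2 le_rfl one_pos
  · exact hsub_one lam' s' hlt hlam'.1 hlt1

/-- compact embedding `C^{k,𝐬(s,λ,δ)}_T ↪ C^{k,𝐬(s',λ',δ')}_T`. -/
theorem stmt2 (n : ℕ) (s s' k : ℕ) (δ δ' lam lam' T : ℝ)
    (hδ'0 : 0 ≤ δ') (hδ : δ' < δ) (hlam : lam ∈ Set.Icc (0 : ℝ) 1)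
    (hlam' : lam' ∈ Set.Icc (0 : ℝ) 1) (hT : 0 < T)
    (hord : (s' : ℝ) + lam' < (s : ℝ) + lam) :
    ∀ u : ℕ → ℝ → Spc n → ℝ,
      (∃ C : ℝ≥0∞, C ≠ ⊤ ∧ ∀ m, AnisoMem T k s lam δ (u m) ∧
        eAnisoKS T k s lam δ (u m) ≤ C) →
      ∃ φ : ℕ → ℕ, StrictMono φ ∧ ∃ v : ℝ → Spc n → ℝ, AnisoMem T k s' lam' δ' v ∧
        Tendsto (fun m => eAnisoKS T k s' lam' δ' (u (φ m) - v)) atTop (nhds 0) := by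
  rintro u ⟨C, hC, hu⟩
  have hreg : ∀ N, AnisoReg T k s (u N) := fun N => (hu N).1.1
  have hb : ∀ N, KSBound T k s lam δ C.toReal (u N) := fun N =>
    KSBound.of_eAnisoKS_le ENNReal.toReal_nonneg (by
      rw [ENNReal.ofReal_toReal hC]
      exact (hu N).2)
  obtain ⟨φ, hφ, v, hv, ⟨C', hC'⟩, hlim⟩ :=
    hasConvSubseq_of_order_lt hT hδ'0 hδ hlam hlam' hord hreg hb
  refine ⟨φ, hφ, v, ⟨hv, ?_⟩, ?_⟩
  · exact ne_top_of_le_ne_top (ENNReal.mul_ne_top (ENNReal.natCast_ne_top _) ENNReal.ofReal_ne_top)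
      (hC'.eAnisoKS_le hT hδ'0)
  · rw [ENNReal.tendsto_nhds_zero]
    intro ε hε
    set M : ℕ := (k + 1) * ((2 * s' + 1) * (s' + 1))
    have hc : Tendsto (fun η : ℝ => (M : ℝ≥0∞) * ENNReal.ofReal (5 * η)) (nhdsWithin 0 (Set.Ioi 0))
        (nhds 0) := by
      have h1 : Continuous fun η : ℝ => (M : ℝ≥0∞) * ENNReal.ofReal (5 * η) :=
        (ENNReal.continuous_const_mul (ENNReal.natCast_ne_top M)).comp
          (ENNReal.continuous_ofReal.comp (continuous_const.mul continuous_id))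
      have h2 := h1.tendsto 0
      simp only [mul_zero, ENNReal.ofReal_zero] at h2
      exact h2.mono_left nhdsWithin_le_nhds
    obtain ⟨η, hη, hη0⟩ :=
      ((ENNReal.tendsto_nhds_zero.1 hc ε hε).and self_mem_nhdsWithin).exists
    filter_upwards [hlim η hη0] with N hN
    exact (hN.eAnisoKS_le hT hδ'0).trans hη
end NSdeRham

end
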